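/- Given finitely many unit vectors v_f in \mathbb{R}^3 (Euclidean) or \mathbb{R}^{2,1} (Minkowski, none light-like), not all contained in a plane, and positive numbers A_f satisfying the closure condition Σ_f A_f v_f = 0, there exists a convex polyhedron, unique up to translation, whose faces have outward unit normals v_f and areas A_f (Minkowski's theorem in Lorentzian signature). -/

import Mathlib

open MeasureTheory

noncomputable section

/-- The Minkowski bilinear form on `ℝ^{2,1}` (signature `(+,-,-)`). -/
def mink (x y : EuclideanSpace ℝ (Fin 3)) : ℝ := x 0 * y 0 - x 1 * y 1 - x 2 * y 2

/-- The face of a convex body `P` with (Minkowski-)outward normal `v`: the set of points of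
`P` maximising the Minkowski pairing with `v`. -/
def mface (P : Set (EuclideanSpace ℝ (Fin 3))) (v : EuclideanSpace ℝ (Fin 3)) :
    Set (EuclideanSpace ℝ (Fin 3)) :=
  {x ∈ P | ∀ y ∈ P, mink y v ≤ mink x v}

/-- The Minkowskian area of a face with Minkowski-unit normal `v`: the 2-dimensional
Hausdorff measure corrected by the factor `1/‖v‖` relating the Euclidean and Minkowskian
induced area elements on the hyperplane orthogonal (w.r.t. `mink`) to a `mink`-unit `v`. -/
def minkArea (S : Set (EuclideanSpace ℝ (Fin 3))) (v : EuclideanSpace ℝ (Fin 3)) : ℝ :=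
  (μH[2] S).toReal / ‖v‖

lemma bm_one {A B C : Set ℝ} (hA : MeasurableSet A) (hB : MeasurableSet B)
    (hA0 : A.Nonempty) (hB0 : B.Nonempty)
    (h : ∀ a ∈ A, ∀ b ∈ B, (a + b) / 2 ∈ C) :
    volume A + volume B ≤ 2 * volume C := by
  have key : ∀ A' B' : Set ℝ, A' ⊆ A → B' ⊆ B → IsCompact A' → IsCompact B' → A'.Nonempty →
      B'.Nonempty → volume A' + volume B' ≤ 2 * volume C := by
    intro A' B' hAA hBB hcA hcB hnA hnB
    obtain ⟨a, haA, ha⟩ := hcA.exists_isGreatest hnA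
    obtain ⟨b, hbB, hb⟩ := hcB.exists_isLeast hnB
    have h2 : volume ((fun x : ℝ => 2⁻¹ * x) ⁻¹' C) = 2 * volume C := by
      rw [Real.volume_preimage_mul_left (by norm_num)]
      norm_num
    rw [← h2]
    have e1 : volume A' = volume ((fun x => x + (-b)) ⁻¹' A') := by
      rw [measure_preimage_add_right]
    have e2 : volume B' = volume ((fun x => x + (-a)) ⁻¹' B') := by
      rw [measure_preimage_add_right]
    rw [e1, e2]
    have hm : MeasurableSet ((fun x => x + (-a)) ⁻¹' B') :=
      hcB.measurableSet.preimage (measurable_id.add_const _)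
    rw [← measure_union₀ hm.nullMeasurableSet]
    · apply measure_mono
      rintro x (hx | hx)
      · have := h _ (hAA hx) _ (hBB hbB)
        simp only [Set.mem_preimage] at *
        convert this using 1; ring
      · have := h _ (hAA haA) _ (hBB hx)
        simp only [Set.mem_preimage] at *
        convert this using 1; ring
    · refine measure_mono_null (t := {a + b}) ?_ (by simp)
      rintro x ⟨h1, h2⟩
      have h1 := ha h1
      have h2 := hb h2
      simp only [Set.mem_singleton_iff] at *
      linarith
  obtain ⟨a0, ha0⟩ := hA0
  obtain ⟨b0, hb0⟩ := hB0
  rw [hA.measure_eq_iSup_isCompact, hB.measure_eq_iSup_isCompact]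
  simp only [iSup_and']
  refine ENNReal.biSup_add_biSup_le' (p := fun K => K ⊆ A ∧ IsCompact K) (q := fun K => K ⊆ B ∧ IsCompact K) ⟨∅, by simp⟩ ⟨∅, by simp⟩ ?_
  rintro K ⟨hK, hKc⟩ L ⟨hL, hLc⟩
  refine le_trans ?_ (key (insert a0 K) (insert b0 L) (Set.insert_subset ha0 hK)
    (Set.insert_subset hb0 hL) (hKc.insert _) (hLc.insert _) (by simp) (by simp))
  gcongr <;> simp

lemma pl_norm {f g m : ℝ → ℝ} (hf : Measurable f) (hg : Measurable g) (hm : Measurable m)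
    (hf0 : ∀ x, 0 ≤ f x) (hg0 : ∀ x, 0 ≤ g x) (hm0 : ∀ x, 0 ≤ m x)
    (hf1 : ∀ x, f x ≤ 1) (hg1 : ∀ x, g x ≤ 1)
    (hfs : ∀ t < 1, ∃ x, t < f x) (hgs : ∀ t < 1, ∃ x, t < g x)
    (h : ∀ x y t, 0 ≤ t → t < f x → t < g y → t < m ((x + y) / 2)) :
    (∫⁻ x, ENNReal.ofReal (f x)) + (∫⁻ x, ENNReal.ofReal (g x)) ≤
      2 * ∫⁻ x, ENNReal.ofReal (m x) := by
  have red : ∀ k : ℝ → ℝ, (∀ x, k x ≤ 1) → ∀ t : ℝ, 1 ≤ t → volume {x | t < k x} = 0 := by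
    intro k hk t ht
    have : {x | t < k x} = ∅ := by
      ext x; simp; linarith [hk x]
    simp [this]
  rw [lintegral_eq_lintegral_meas_lt volume (Filter.Eventually.of_forall hf0) hf.aemeasurable,
    lintegral_eq_lintegral_meas_lt volume (Filter.Eventually.of_forall hg0) hg.aemeasurable,
    lintegral_eq_lintegral_meas_lt volume (Filter.Eventually.of_forall hm0) hm.aemeasurable,
    ← lintegral_const_mul', ← lintegral_add_left']
  · apply setLIntegral_mono' measurableSet_Ioi
    intro t ht
    by_cases h1 : t < 1
    · exact bm_one (measurableSet_lt measurable_const hf) (measurableSet_lt measurable_const hg)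
        (hfs t h1) (hgs t h1) (fun a ha b hb => h a b t (le_of_lt ht) ha hb)
    · rw [red f hf1 t (not_lt.1 h1), red g hg1 t (not_lt.1 h1)]; simp
  · apply Measurable.aemeasurable
    apply Antitone.measurable
    intro s t hst
    exact measure_mono (fun x hx => lt_of_le_of_lt hst hx)
  · simp

lemma pl_one {f g m : ℝ → ℝ} (hf : Measurable f) (hg : Measurable g) (hm : Measurable m)
    (hf0 : ∀ x, 0 ≤ f x) (hg0 : ∀ x, 0 ≤ g x) (hm0 : ∀ x, 0 ≤ m x)
    (hfi : Integrable f) (hgi : Integrable g) (hmi : Integrable m)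
    (hfb : BddAbove (Set.range f)) (hgb : BddAbove (Set.range g))
    (h : ∀ x y, f x * g y ≤ m ((x + y) / 2) ^ 2) :
    (∫ x, f x) * (∫ x, g x) ≤ (∫ x, m x) ^ 2 := by
  set a := ⨆ x, f x with ha
  set b := ⨆ x, g x with hb
  have hfa : ∀ x, f x ≤ a := fun x => le_ciSup hfb x
  have hgb' : ∀ x, g x ≤ b := fun x => le_ciSup hgb x
  have ha0 : 0 ≤ a := (hf0 0).trans (hfa 0)
  have hb0 : 0 ≤ b := (hg0 0).trans (hgb' 0)
  rcases ha0.eq_or_lt with ha1 | ha1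
  · have : f = 0 := by ext x; exact le_antisymm ((hfa x).trans ha1.symm.le) (hf0 x)
    simp [this]; positivity
  rcases hb0.eq_or_lt with hb1 | hb1
  · have : g = 0 := by ext x; exact le_antisymm ((hgb' x).trans hb1.symm.le) (hg0 x)
    simp [this]; positivity
  set c := Real.sqrt (a * b) with hc
  have hc0 : 0 < c := by positivity
  have hc2 : c ^ 2 = a * b := Real.sq_sqrt (by positivity)
  have key := pl_norm (f := fun x => f x / a) (g := fun x => g x / b) (m := fun x => m x / c)
    (hf.div_const _) (hg.div_const _) (hm.div_const _)
    (fun x => div_nonneg (hf0 x) ha0) (fun x => div_nonneg (hg0 x) hb0)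
    (fun x => div_nonneg (hm0 x) hc0.le)
    (fun x => (div_le_one ha1).2 (hfa x)) (fun x => (div_le_one hb1).2 (hgb' x))
    (by
      intro t ht
      obtain ⟨x, hx⟩ := exists_lt_of_lt_ciSup (show t * a < ⨆ x, f x by rw [← ha]; nlinarith)
      exact ⟨x, (lt_div_iff₀ ha1).2 hx⟩)
    (by
      intro t ht
      obtain ⟨x, hx⟩ := exists_lt_of_lt_ciSup (show t * b < ⨆ x, g x by rw [← hb]; nlinarith)
      exact ⟨x, (lt_div_iff₀ hb1).2 hx⟩)
    (by
      intro x y t ht h1 h2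
      rw [lt_div_iff₀ ha1] at h1
      rw [lt_div_iff₀ hb1] at h2
      rw [lt_div_iff₀ hc0]
      apply lt_of_pow_lt_pow_left₀ 2 (hm0 _)
      refine lt_of_lt_of_le ?_ (h x y)
      calc (t * c) ^ 2 = (t * a) * (t * b) := by rw [mul_pow, hc2]; ring
        _ < f x * g y := mul_lt_mul'' h1 h2 (by positivity) (by positivity))
  rw [← ofReal_integral_eq_lintegral_ofReal (hfi.div_const _)
      (Filter.Eventually.of_forall fun x => div_nonneg (hf0 x) ha0),
    ← ofReal_integral_eq_lintegral_ofReal (hgi.div_const _)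
      (Filter.Eventually.of_forall fun x => div_nonneg (hg0 x) hb0),
    ← ofReal_integral_eq_lintegral_ofReal (hmi.div_const _)
      (Filter.Eventually.of_forall fun x => div_nonneg (hm0 x) hc0.le)] at key
  have i1 : 0 ≤ ∫ x, f x := integral_nonneg hf0
  have i2 : 0 ≤ ∫ x, g x := integral_nonneg hg0
  have i3 : 0 ≤ ∫ x, m x := integral_nonneg hm0
  simp only [integral_div] at key
  rw [← ENNReal.ofReal_add (by positivity) (by positivity),
    show (2 : ENNReal) = ENNReal.ofReal 2 by simp, ← ENNReal.ofReal_mul (by norm_num),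
    ENNReal.ofReal_le_ofReal_iff (by positivity)] at key
  set X := ∫ x, f x
  set Y := ∫ x, g x
  set Z := ∫ x, m x
  have k2 : (X / a + Y / b) ^ 2 ≤ (2 * (Z / c)) ^ 2 := by gcongr
  have k3 : X / a * (Y / b) ≤ (Z / c) ^ 2 := by nlinarith [sq_nonneg (X / a - Y / b)]
  rw [div_mul_div_comm, div_pow, hc2, div_le_div_iff_of_pos_right (by positivity)] at k3
  exact k3

lemma bm_two {K L M : Set (ℝ × ℝ)} (hK : MeasurableSet K) (hL : MeasurableSet L)
    (hM : MeasurableSet M) (hKb : Bornology.IsBounded K) (hLb : Bornology.IsBounded L)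
    (hMb : Bornology.IsBounded M)
    (h : ∀ x ∈ K, ∀ y ∈ L, (((x.1 + y.1) / 2, (x.2 + y.2) / 2) : ℝ × ℝ) ∈ M) :
    volume.real K * volume.real L ≤ volume.real M ^ 2 := by
  have slice : ∀ Q : Set (ℝ × ℝ), MeasurableSet Q → Bornology.IsBounded Q →
      Measurable (fun x : ℝ => volume.real (Prod.mk x ⁻¹' Q)) ∧
      Integrable (fun x : ℝ => volume.real (Prod.mk x ⁻¹' Q)) ∧
      volume.real Q = ∫ x : ℝ, volume.real (Prod.mk x ⁻¹' Q) ∧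
      (BddAbove (Set.range fun x : ℝ => volume.real (Prod.mk x ⁻¹' Q))) ∧
      (∀ x : ℝ, volume (Prod.mk x ⁻¹' Q) ≠ ⊤) := by
    intro Q hQ hQb
    have hfin : volume Q ≠ ⊤ := hQb.measure_lt_top.ne
    have m1 : Measurable (fun x : ℝ => volume (Prod.mk x ⁻¹' Q)) := measurable_measure_prodMk_left hQ
    have e1 : volume Q = ∫⁻ x : ℝ, volume (Prod.mk x ⁻¹' Q) := by
      rw [Measure.volume_eq_prod, Measure.prod_apply hQ]
    obtain ⟨R, hR⟩ := hQb.subset_closedBall 0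
    have sub : ∀ x : ℝ, Prod.mk x ⁻¹' Q ⊆ Metric.closedBall 0 R := by
      intro x y hy
      have := hR hy
      simp only [mem_closedBall_zero_iff, Prod.norm_def, sup_le_iff] at this ⊢
      exact this.2
    have fin : ∀ x : ℝ, volume (Prod.mk x ⁻¹' Q) ≠ ⊤ := fun x =>
      ((measure_mono (sub x)).trans_lt measure_closedBall_lt_top).ne
    refine ⟨m1.ennreal_toReal, integrable_toReal_of_lintegral_ne_top m1.aemeasurable (e1 ▸ hfin),
      ?_, ⟨volume.real (Metric.closedBall (0:ℝ) R), ?_⟩, fin⟩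
    · simp only [measureReal_def]
      rw [integral_toReal m1.aemeasurable (Filter.Eventually.of_forall fun x => (fin x).lt_top), ← e1]
    · rintro _ ⟨x, rfl⟩
      exact measureReal_mono (sub x) measure_closedBall_lt_top.ne
  obtain ⟨k1, k2, k3, k4, k5⟩ := slice K hK hKb
  obtain ⟨l1, l2, l3, l4, l5⟩ := slice L hL hLb
  obtain ⟨m1, m2, m3, m4, m5⟩ := slice M hM hMb
  rw [k3, l3, m3]
  refine pl_one k1 l1 m1 (fun _ => measureReal_nonneg) (fun _ => measureReal_nonneg)
    (fun _ => measureReal_nonneg) k2 l2 m2 k4 l4 ?_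
  intro x y
  rcases (Prod.mk x ⁻¹' K).eq_empty_or_nonempty with h1 | h1
  · simp [h1]
  rcases (Prod.mk y ⁻¹' L).eq_empty_or_nonempty with h2 | h2
  · simp [h2]
  have := bm_one (C := Prod.mk ((x + y) / 2) ⁻¹' M) (hK.preimage measurable_prodMk_left)
    (hL.preimage measurable_prodMk_left) h1 h2
    (fun a ha b hb => h _ ha _ hb)
  have t := ENNReal.toReal_mono (ENNReal.mul_ne_top (by simp) (m5 _)) this
  rw [ENNReal.toReal_add (k5 _) (l5 _), ENNReal.toReal_mul] at t
  simp only [← measureReal_def] at t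
  simp only [ENNReal.toReal_ofNat] at t
  have n1 : 0 ≤ volume.real (Prod.mk x ⁻¹' K) := measureReal_nonneg
  have n2 : 0 ≤ volume.real (Prod.mk y ⁻¹' L) := measureReal_nonneg
  have t2 := pow_le_pow_left₀ (by positivity) t 2
  nlinarith [sq_nonneg (volume.real (Prod.mk x ⁻¹' K) - volume.real (Prod.mk y ⁻¹' L))]

lemma inv_cdf {G a : ℝ → ℝ} {α β V : ℝ} (hαβ : α < β) (hc : ContinuousOn G (Set.Icc α β))
    (h0 : G α = 0) (h1 : G β = V) (hd : ∀ x ∈ Set.Ioo α β, HasDerivAt G (a x) x)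
    (ha : ∀ x ∈ Set.Ioo α β, 0 < a x) :
    0 < V ∧ ∃ s : ℝ → ℝ, Continuous s ∧ s 0 = α ∧ s V = β ∧
      (∀ x ∈ Set.Icc α β, G x ∈ Set.Icc 0 V ∧ s (G x) = x) ∧
      ∀ q ∈ Set.Ioo 0 V, s q ∈ Set.Ioo α β ∧ G (s q) = q ∧ HasDerivAt s (a (s q))⁻¹ q := by
  have hm : StrictMonoOn G (Set.Icc α β) := by
    apply strictMonoOn_of_deriv_pos (convex_Icc _ _) hc
    intro x hx
    rw [interior_Icc] at hx
    rw [(hd x hx).deriv]; exact ha x hx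
  have hV : 0 < V := by
    rw [← h0, ← h1]
    exact hm (Set.left_mem_Icc.2 hαβ.le) (Set.right_mem_Icc.2 hαβ.le) hαβ
  refine ⟨hV, ?_⟩
  have him : G '' Set.Icc α β = Set.Icc 0 V := by
    apply Set.Subset.antisymm
    · rintro _ ⟨x, hx, rfl⟩
      refine ⟨?_, ?_⟩
      · rw [← h0]; exact hm.monotoneOn (Set.left_mem_Icc.2 hαβ.le) hx hx.1
      · rw [← h1]; exact hm.monotoneOn hx (Set.right_mem_Icc.2 hαβ.le) hx.2
    · have := intermediate_value_Icc hαβ.le hc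
      rwa [h0, h1] at this
  let e : Set.Icc α β ≃o Set.Icc 0 V := (hm.orderIso G _).trans (OrderIso.setCongr _ _ him)
  have he : ∀ x, ((e x : Set.Icc 0 V) : ℝ) = G x := fun x => rfl
  let s : ℝ → ℝ := Set.IccExtend hV.le (fun q => ((e.symm q : Set.Icc α β) : ℝ))
  have hs : Continuous s := by
    apply Continuous.Icc_extend'
    exact continuous_subtype_val.comp e.symm.continuous
  have hsq : ∀ (q : ℝ) (hq : q ∈ Set.Icc 0 V), s q = (e.symm ⟨q, hq⟩ : Set.Icc α β) := by
    intro q hq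
    exact Set.IccExtend_of_mem _ _ hq
  have hGs : ∀ q ∈ Set.Icc 0 V, s q ∈ Set.Icc α β ∧ G (s q) = q := by
    intro q hq
    rw [hsq q hq]
    refine ⟨(e.symm _).2, ?_⟩
    rw [← he, OrderIso.apply_symm_apply]
  have hsG : ∀ x ∈ Set.Icc α β, G x ∈ Set.Icc 0 V ∧ s (G x) = x := by
    intro x hx
    have h2 : G x ∈ Set.Icc 0 V := him ▸ Set.mem_image_of_mem G hx
    refine ⟨h2, ?_⟩
    rw [hsq _ h2]
    have : (⟨G x, h2⟩ : Set.Icc 0 V) = e ⟨x, hx⟩ := Subtype.ext (he ⟨x, hx⟩).symm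
    rw [this, OrderIso.symm_apply_apply]
  refine ⟨s, hs, ?_, ?_, hsG, ?_⟩
  · rw [← h0]; exact (hsG α (Set.left_mem_Icc.2 hαβ.le)).2
  · rw [← h1]; exact (hsG β (Set.right_mem_Icc.2 hαβ.le)).2
  · intro q hq
    obtain ⟨m1, m2⟩ := hGs q ⟨hq.1.le, hq.2.le⟩
    have m3 : s q ∈ Set.Ioo α β := by
      refine ⟨lt_of_le_of_ne m1.1 ?_, lt_of_le_of_ne m1.2 ?_⟩
      · intro h; rw [← h, h0] at m2; exact hq.1.ne m2
      · intro h; rw [h, h1] at m2; exact hq.2.ne m2.symm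
    refine ⟨m3, m2, ?_⟩
    apply HasDerivAt.of_local_left_inverse hs.continuousAt (hd _ m3) (ha _ m3).ne'
    filter_upwards [Ioo_mem_nhds hq.1 hq.2] with r hr
    exact (hGs r ⟨hr.1.le, hr.2.le⟩).2

lemma transport {G₁ G₂ G a₁ a₂ a : ℝ → ℝ} {α₁ β₁ α₂ β₂ V : ℝ}
    (h₁ : α₁ < β₁) (hc₁ : ContinuousOn G₁ (Set.Icc α₁ β₁))
    (h₁0 : G₁ α₁ = 0) (h₁1 : G₁ β₁ = V) (hd₁ : ∀ x ∈ Set.Ioo α₁ β₁, HasDerivAt G₁ (a₁ x) x)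
    (ha₁ : ∀ x ∈ Set.Ioo α₁ β₁, 0 < a₁ x)
    (h₂ : α₂ < β₂) (hc₂ : ContinuousOn G₂ (Set.Icc α₂ β₂))
    (h₂0 : G₂ α₂ = 0) (h₂1 : G₂ β₂ = V) (hd₂ : ∀ x ∈ Set.Ioo α₂ β₂, HasDerivAt G₂ (a₂ x) x)
    (ha₂ : ∀ x ∈ Set.Ioo α₂ β₂, 0 < a₂ x)
    (hc : Continuous G) (hG0 : 0 ≤ G ((α₁ + α₂) / 2)) (hG1 : G ((β₁ + β₂) / 2) ≤ V)
    (hd : ∀ x ∈ Set.Ioo α₁ β₁, ∀ y ∈ Set.Ioo α₂ β₂,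
      HasDerivAt G (a ((x + y) / 2)) ((x + y) / 2))
    (ha0 : ∀ x, 0 ≤ a x)
    (ha : ∀ x ∈ Set.Ioo α₁ β₁, ∀ y ∈ Set.Ioo α₂ β₂, a₁ x * a₂ y ≤ a ((x + y) / 2) ^ 2) :
    ∃ δ, α₂ = α₁ + δ ∧ β₂ = β₁ + δ ∧ ∀ x ∈ Set.Icc α₁ β₁, G₂ (x + δ) = G₁ x := by
  obtain ⟨hV, s, hs, s0, s1, sG, hsd⟩ := inv_cdf h₁ hc₁ h₁0 h₁1 hd₁ ha₁
  obtain ⟨-, r, hr, r0, r1, rG, hrd⟩ := inv_cdf h₂ hc₂ h₂0 h₂1 hd₂ ha₂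
  let k : ℝ → ℝ := fun q => G ((s q + r q) / 2) - q
  have hk : Continuous k := (hc.comp ((hs.add hr).div_const _)).sub continuous_id
  have hkd : ∀ q ∈ Set.Ioo 0 V, HasDerivAt k
      (a ((s q + r q) / 2) * (((a₁ (s q))⁻¹ + (a₂ (r q))⁻¹) / 2) - 1) q := by
    intro q hq
    obtain ⟨p1, p2, p3⟩ := hsd q hq
    obtain ⟨q1, q2, q3⟩ := hrd q hq
    have := (hd _ p1 _ q1).comp q (h := fun q => (s q + r q) / 2) ((p3.add q3).div_const 2)
    exact this.sub (hasDerivAt_id q)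
  have alg : ∀ x y z : ℝ, 0 < x → 0 < y → 0 ≤ z → x * y ≤ z ^ 2 →
      0 ≤ z * ((x⁻¹ + y⁻¹) / 2) - 1 ∧ (z * ((x⁻¹ + y⁻¹) / 2) - 1 = 0 → x = y) := by
    intro x y z hx hy hz h
    have e : z * ((x⁻¹ + y⁻¹) / 2) - 1 = (z * (x + y) - 2 * (x * y)) / (2 * (x * y)) := by
      field_simp
      ring
    have hxy : 0 < x * y := by positivity
    have hle : 2 * (x * y) ≤ z * (x + y) := by
      refine (pow_le_pow_iff_left₀ (by positivity) (by positivity) two_ne_zero).1 ?_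
      nlinarith [sq_nonneg (x - y), mul_le_mul_of_nonneg_right h (sq_nonneg (x + y))]
    rw [e]
    refine ⟨div_nonneg (by linarith) (by positivity), ?_⟩
    intro h0
    rw [div_eq_zero_iff] at h0
    have h0 : z * (x + y) = 2 * (x * y) := by
      rcases h0 with h0 | h0
      · linarith
      · nlinarith
    have h3 : (x * y) * (x - y) ^ 2 ≤ 0 := by
      have : (z * (x + y)) ^ 2 = (2 * (x * y)) ^ 2 := by rw [h0]
      nlinarith [mul_le_mul_of_nonneg_right h (sq_nonneg (x + y))]
    have h4 : (x - y) ^ 2 = 0 := by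
      apply le_antisymm _ (sq_nonneg _)
      by_contra hh
      push Not at hh
      nlinarith [mul_pos hxy hh]
    have := pow_eq_zero_iff (two_ne_zero) |>.1 h4
    linarith
  have algq : ∀ q ∈ Set.Ioo 0 V, _ := fun q hq =>
    alg _ _ _ (ha₁ _ (hsd q hq).1) (ha₂ _ (hrd q hq).1) (ha0 ((s q + r q) / 2))
      (ha _ (hsd q hq).1 _ (hrd q hq).1)
  have kmono : MonotoneOn k (Set.Icc 0 V) := by
    apply monotoneOn_of_deriv_nonneg (convex_Icc _ _) hk.continuousOn
    · intro q hq
      rw [interior_Icc] at hq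
      exact (hkd q hq).differentiableAt.differentiableWithinAt
    · intro q hq
      rw [interior_Icc] at hq
      rw [(hkd q hq).deriv]
      exact (algq q hq).1
  have kz : ∀ q ∈ Set.Icc 0 V, k q = 0 := by
    intro q hq
    have l1 := kmono (Set.left_mem_Icc.2 hV.le) hq hq.1
    have l2 := kmono hq (Set.right_mem_Icc.2 hV.le) hq.2
    have e1 : 0 ≤ k 0 := by simp only [k, s0, r0]; linarith
    have e2 : k V ≤ 0 := by simp only [k, s1, r1]; linarith
    linarith
  have eqa : ∀ q ∈ Set.Ioo 0 V, a₁ (s q) = a₂ (r q) := by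
    intro q hq
    apply (algq q hq).2
    apply (hkd q hq).unique
    apply (hasDerivAt_const q (0:ℝ)).congr_of_eventuallyEq
    filter_upwards [Ioo_mem_nhds hq.1 hq.2] with p hp
    exact kz p ⟨hp.1.le, hp.2.le⟩
  have cst : ∀ q ∈ Set.Icc 0 V, r q - s q = α₂ - α₁ := by
    intro q hq
    rcases hq.1.eq_or_lt with h0 | h0
    · rw [← h0, r0, s0]
    obtain ⟨c, hc, hc2⟩ := exists_hasDerivAt_eq_slope (fun q => r q - s q)
      (fun q => (a₂ (r q))⁻¹ - (a₁ (s q))⁻¹) h0 (hr.sub hs).continuousOn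
      (fun p hp => (hrd p ⟨hp.1, hp.2.trans_le hq.2⟩).2.2.sub
        (hsd p ⟨hp.1, hp.2.trans_le hq.2⟩).2.2)
    rw [eqa c ⟨hc.1, hc.2.trans_le hq.2⟩, sub_self, eq_comm, div_eq_zero_iff] at hc2
    simp only [r0, s0] at hc2
    rcases hc2 with h | h <;> linarith
  have b1 := cst V (Set.right_mem_Icc.2 hV.le)
  rw [r1, s1] at b1
  refine ⟨α₂ - α₁, by ring, by linarith, ?_⟩
  intro x hx
  obtain ⟨g1, g2⟩ := sG x hx
  obtain ⟨w1, w2⟩ := rG (x + (α₂ - α₁)) ⟨by linarith [hx.1], by linarith [hx.2]⟩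
  have c1 := cst _ g1
  rw [g2] at c1
  have c2 : r (G₁ x) = x + (α₂ - α₁) := by linarith
  -- injectivity of r on Icc 0 V
  obtain ⟨y, hy, hy2⟩ := intermediate_value_Icc h₂.le hc₂ (show G₁ x ∈ Set.Icc (G₂ α₂) (G₂ β₂) by
    rw [h₂0, h₂1]; exact g1)
  have := (rG y hy).2
  rw [hy2, c2] at this
  rw [this, hy2]

abbrev E3 := EuclideanSpace ℝ (Fin 3)

/-- the constant relating `μH[2]` and the Lebesgue measure. -/
def hausC : NNReal :=
  Measure.addHaarScalarFactor (μH[(2 : ℕ)] : Measure (EuclideanSpace ℝ (Fin 2))) volume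

lemma hausC_pos : 0 < hausC :=
  Measure.addHaarScalarFactor_pos_of_isAddHaarMeasure _ _

/-- adapted coordinates for the normal `w`. -/
structure Chart (w : E3) where
  n : E3
  p : E3
  q : E3
  hn : inner ℝ n w = 1
  hp : inner ℝ p w = 0
  hq : inner ℝ q w = 0
  ha : ∀ s a b : ℝ, |a| ≤ ‖s • n + a • p + b • q‖
  hb : ∀ s a b : ℝ, |b| ≤ ‖s • n + a • p + b • q‖
  perp : ∀ z, inner ℝ p z = 0 → inner ℝ q z = 0 → z = (inner ℝ n z : ℝ) • w
  vol : ∀ K : Set E3, MeasurableSet K →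
    volume K = ENNReal.ofReal ‖w‖⁻¹ * ∫⁻ s : ℝ, volume {y : ℝ × ℝ | s • n + y.1 • p + y.2 • q ∈ K}
  haus : ∀ (K : Set E3) (s : ℝ), MeasurableSet K → μH[2] (K ∩ {x | inner ℝ x w = s}) =
    (hausC : ENNReal) * volume {y : ℝ × ℝ | s • n + y.1 • p + y.2 • q ∈ K}

lemma exists_chart (w : E3) (hw : w ≠ 0) : Nonempty (Chart w) := by
  have hw' : 0 < ‖w‖ := norm_pos_iff.2 hw
  obtain ⟨b, hb⟩ := Orthonormal.exists_orthonormalBasis_extension_of_card_eq (𝕜 := ℝ) (E := E3)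
    (ι := Fin 3) (by simp) (v := fun _ => ‖w‖⁻¹ • w) (s := {0}) (by
      constructor
      · rintro ⟨i, hi⟩
        simp [Set.domRestrict, norm_smul, hw'.ne']
      · rintro ⟨i, hi⟩ ⟨j, hj⟩ hij
        simp at hi hj
        exact absurd (Subtype.ext (hi.trans hj.symm)) hij)
  have hb0 : b 0 = ‖w‖⁻¹ • w := hb 0 rfl
  have hwb : w = ‖w‖ • b 0 := by rw [hb0, smul_smul, mul_inv_cancel₀ hw'.ne', one_smul]
  have o : ∀ i j, inner ℝ (b i) (b j) = if i = j then (1:ℝ) else 0 := by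
    intro i j; exact (orthonormal_iff_ite.1 b.orthonormal) i j
  have o' : ∀ i, inner ℝ (b i) w = if i = 0 then ‖w‖ else 0 := by
    intro i
    conv_lhs => rw [hwb]
    rw [inner_smul_right, o]; split_ifs <;> simp
  have hsum : ∀ s t r : ℝ, b.repr.symm (WithLp.toLp 2 ![s, t, r]) = s • b 0 + t • b 1 + r • b 2 := by
    intro s t r
    rw [← OrthonormalBasis.sum_repr_symm]
    simp [Fin.sum_univ_three]
  have hnorm : ∀ s t r : ℝ, ‖s • b 0 + t • b 1 + r • b 2‖ = Real.sqrt (s ^ 2 + t ^ 2 + r ^ 2) := by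
    intro s t r
    rw [← hsum, LinearIsometryEquiv.norm_map, EuclideanSpace.norm_eq]
    simp [Fin.sum_univ_three]
  have hsn : ∀ s : ℝ, s • (‖w‖⁻¹ • b 0) = (s * ‖w‖⁻¹) • b 0 := fun s => by rw [smul_smul]
  refine ⟨⟨‖w‖⁻¹ • b 0, b 1, b 2, ?_, ?_, ?_, ?_, ?_, ?_, ?_, ?_⟩⟩
  · rw [inner_smul_left, o']; simp [hw'.ne']
  · rw [o']; simp
  · rw [o']; simp
  · intro s t r
    rw [hsn, hnorm]
    apply Real.abs_le_sqrt
    nlinarith [sq_nonneg (s * ‖w‖⁻¹), sq_nonneg r]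
  · intro s t r
    rw [hsn, hnorm]
    apply Real.abs_le_sqrt
    nlinarith [sq_nonneg (s * ‖w‖⁻¹), sq_nonneg t]
  · intro z h1 h2
    have := b.sum_repr z
    simp only [Fin.sum_univ_three, OrthonormalBasis.repr_apply_apply, h1, h2, zero_smul, add_zero] at this
    conv_lhs => rw [← this]
    rw [inner_smul_left]
    have e : ∀ c : ℝ, (‖w‖⁻¹ * c) • w = c • b 0 := by
      intro c; rw [hb0, smul_smul, mul_comm]
    exact (e _).symm
  · intro K hK
    let T : ℝ × (ℝ × ℝ) → E3 := fun y => y.1 • b 0 + y.2.1 • b 1 + y.2.2 • b 2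
    have hT : MeasurePreserving T := by
      have m1 : MeasurePreserving (Prod.map id MeasurableEquiv.finTwoArrow.symm : ℝ × (ℝ × ℝ) → ℝ × (Fin 2 → ℝ)) :=
        (MeasurePreserving.id volume).prod (volume_preserving_finTwoArrow ℝ).symm
      have m2 := (volume_preserving_piFinSuccAbove (fun _ : Fin 3 => ℝ) 0).symm
      have m3 := PiLp.volume_preserving_toLp (Fin 3)
      have m4 := b.measurePreserving_repr_symm
      have := m4.comp (m3.comp (m2.comp m1))
      have hTe : T = b.repr.symm ∘ WithLp.toLp 2 ∘
          (MeasurableEquiv.piFinSuccAbove (fun _ : Fin 3 => ℝ) 0).symm ∘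
          Prod.map id MeasurableEquiv.finTwoArrow.symm := by
        funext y
        obtain ⟨y0, y1, y2⟩ := y
        simp only [T, Function.comp]
        rw [← hsum]
        congr 2
        funext i
        fin_cases i <;> rfl
      rw [hTe]
      exact this
    rw [← hT.measure_preimage hK.nullMeasurableSet, Measure.volume_eq_prod,
      Measure.prod_apply (hT.measurable hK)]
    have hmeas : Measurable (fun s : ℝ => volume {y : ℝ × ℝ | s • (‖w‖⁻¹ • b 0) + y.1 • b 1 + y.2 • b 2 ∈ K}) := by
      have : MeasurableSet ((fun y : ℝ × (ℝ × ℝ) => y.1 • (‖w‖⁻¹ • b 0) + y.2.1 • b 1 + y.2.2 • b 2) ⁻¹' K) := by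
        apply hK.preimage
        fun_prop
      exact measurable_measure_prodMk_left this
    conv_rhs => rw [← Real.smul_map_volume_mul_left (a := ‖w‖) hw'.ne']
    rw [lintegral_smul_measure, lintegral_map hmeas (measurable_const_mul _), smul_eq_mul, ← mul_assoc,
      ← ENNReal.ofReal_mul (by positivity), abs_of_pos hw', inv_mul_cancel₀ hw'.ne']
    simp only [ENNReal.ofReal_one, one_mul]
    apply lintegral_congr
    intro t
    congr 1
    ext y
    simp only [T, Set.mem_preimage, Set.mem_ofPred_eq, hsn]
    rw [show ‖w‖ * t * ‖w‖⁻¹ = t by field_simp]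
  · intro K s hK
    let ι : EuclideanSpace ℝ (Fin 2) → E3 := fun z => s • (‖w‖⁻¹ • b 0) + z 0 • b 1 + z 1 • b 2
    have hι : Isometry ι := by
      apply Isometry.of_dist_eq
      intro x y
      rw [dist_eq_norm, dist_eq_norm]
      have : ι x - ι y = (0:ℝ) • b 0 + (x 0 - y 0) • b 1 + (x 1 - y 1) • b 2 := by
        simp only [ι]; module
      rw [this, hnorm, EuclideanSpace.norm_eq]
      simp [Fin.sum_univ_two]
    have hset : K ∩ {x | inner ℝ x w = s} = ι '' (ι ⁻¹' K) := by
      ext x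
      constructor
      · rintro ⟨hx, hxs⟩
        refine ⟨WithLp.toLp 2 ![inner ℝ (b 1) x, inner ℝ (b 2) x], ?_, ?_⟩
        all_goals
          have hx3 := b.sum_repr x
          simp only [Fin.sum_univ_three, OrthonormalBasis.repr_apply_apply] at hx3
          have : ι (WithLp.toLp 2 ![inner ℝ (b 1) x, inner ℝ (b 2) x]) = x := by
            simp only [ι]
            conv_rhs => rw [← hx3]
            have h0 : inner ℝ (b 0) x = s * ‖w‖⁻¹ := by
              rw [hb0, inner_smul_left, real_inner_comm]
              simp only [Set.mem_ofPred_eq] at hxs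
              rw [hxs]; simp [mul_comm]
            rw [h0, hsn]
            simp
        · rw [Set.mem_preimage, this]; exact hx
        · exact this
      · rintro ⟨z, hz, rfl⟩
        refine ⟨hz, ?_⟩
        simp only [ι, Set.mem_ofPred_eq, inner_add_left, inner_smul_left, o']
        simp [hw'.ne']
    have hmι : MeasurableSet (ι ⁻¹' K) := hK.preimage hι.continuous.measurable
    rw [hset, hι.hausdorffMeasure_image (Or.inl (by norm_num))]
    have h2 : (μH[2] : Measure (EuclideanSpace ℝ (Fin 2))) = hausC • volume := by
      have := Measure.isAddLeftInvariant_eq_smul (μH[(2 : ℕ)] : Measure (EuclideanSpace ℝ (Fin 2))) volume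
      simpa [hausC] using this
    rw [h2, Measure.smul_apply]
    have mp : MeasurePreserving (fun y : ℝ × ℝ => (WithLp.toLp 2 ![y.1, y.2] : EuclideanSpace ℝ (Fin 2))) := by
      have m3 := (PiLp.volume_preserving_toLp (Fin 2)).comp (volume_preserving_finTwoArrow ℝ).symm
      have e : (fun y : ℝ × ℝ => (WithLp.toLp 2 ![y.1, y.2] : EuclideanSpace ℝ (Fin 2))) =
          WithLp.toLp 2 ∘ MeasurableEquiv.finTwoArrow.symm := by
        funext y
        simp only [Function.comp]
        congr 1
      rw [e]
      exact m3
    rw [← mp.measure_preimage hmι.nullMeasurableSet]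
    rfl

lemma null_level {X : Type*} [NormedAddCommGroup X] [NormedSpace ℝ X] [MeasurableSpace X]
    [BorelSpace X] [FiniteDimensional ℝ X] (μ : Measure X) [μ.IsAddHaarMeasure]
    (L : X →ₗ[ℝ] ℝ) (hL : L ≠ 0) (c : ℝ) : μ {x | L x = c} = 0 := by
  rcases Set.eq_empty_or_nonempty {x | L x = c} with h | ⟨x0, hx0⟩
  · simp [h]
  · have : {x | L x = c} = (fun x => x + (-x0)) ⁻¹' (LinearMap.ker L : Set X) := by
      ext x
      have : L x0 = c := hx0
      simp [this, add_neg_eq_zero]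
    rw [this, measure_preimage_add_right]
    apply Measure.addHaar_submodule
    intro h
    exact hL (LinearMap.ker_eq_top.1 h)

lemma cont_tool {F : ℕ} {X : Type*} [MeasurableSpace X] (μ : Measure X)
    (φ : Fin F → (Fin F → ℝ) → X → ℝ) (hm : ∀ g h, Measurable (φ g h))
    (hc : ∀ g x, Continuous fun h => φ g h x) (h₀ : Fin F → ℝ) (B : Set X)
    (hB : MeasurableSet B) (hBf : μ B ≠ ⊤)
    (hdom : ∀ᶠ h in nhds h₀, {x | ∀ g, φ g h x ≤ 0} ⊆ B)
    (hae : ∀ g, ∀ᵐ x ∂μ, φ g h₀ x ≠ 0 ∨ ∀ h, φ g h x ≤ 0) :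
    ContinuousAt (fun h => μ.real {x | ∀ g, φ g h x ≤ 0}) h₀ := by
  have hms : ∀ h, MeasurableSet {x | ∀ g, φ g h x ≤ 0} := by
    intro h
    simp only [Set.ofPred_forall]
    exact MeasurableSet.iInter fun g => measurableSet_le (hm g h) measurable_const
  have := tendsto_measure_of_ae_tendsto_indicator (μ := μ) (nhds h₀) (hms h₀) hms hB hBf hdom (by
    filter_upwards [ae_all_iff.2 hae] with x hx
    have key : ∀ g, ∀ᶠ h in nhds h₀, (φ g h x ≤ 0 ↔ φ g h₀ x ≤ 0) := by
      intro g
      rcases hx g with h1 | h1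
      · rcases lt_or_gt_of_ne h1 with h2 | h2
        · filter_upwards [(hc g x).continuousAt.eventually_lt continuousAt_const h2] with h hh
          exact iff_of_true hh.le h2.le
        · filter_upwards [continuousAt_const.eventually_lt (hc g x).continuousAt h2] with h hh
          exact iff_of_false hh.not_ge h2.not_ge
      · exact Filter.Eventually.of_forall fun h => iff_of_true (h1 h) (h1 h₀)
    filter_upwards [Filter.eventually_all.2 key] with h hh
    exact forall_congr' hh)
  have hfin : μ {x | ∀ g, φ g h₀ x ≤ 0} ≠ ⊤ :=
    ((measure_mono (hdom.self_of_nhds)).trans_lt hBf.lt_top).ne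
  exact (ENNReal.tendsto_toReal hfin).comp this

/-- Data of a family of normals. -/
structure Fan (F : ℕ) where
  w : Fin F → E3
  ch : ∀ f, Chart (w f)
  C : ℝ
  hC : 0 ≤ C
  bdd : ∀ (h : Fin F → ℝ) (x : E3), (∀ f, inner ℝ x (w f) ≤ h f) → ‖x‖ ≤ C * ∑ f, |h f|
  npar : ∀ f g, f ≠ g → ∀ c : ℝ, 0 ≤ c → w g ≠ c • w f

namespace Fan
variable {F : ℕ} (N : Fan F)

def P (h : Fin F → ℝ) : Set E3 := {x | ∀ f, inner ℝ x (N.w f) ≤ h f}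
def V (h : Fin F → ℝ) : ℝ := volume.real (N.P h)
def pt (f : Fin F) (s : ℝ) (y : ℝ × ℝ) : E3 :=
  s • (N.ch f).n + y.1 • (N.ch f).p + y.2 • (N.ch f).q
def Sl (f : Fin F) (h : Fin F → ℝ) : Set (ℝ × ℝ) := {y | N.pt f (h f) y ∈ N.P h}
def S (f : Fin F) (h : Fin F → ℝ) : ℝ := ‖N.w f‖⁻¹ * volume.real (N.Sl f h)
def Feas (h : Fin F → ℝ) : Prop := ∃ x : E3, ∀ f, inner ℝ x (N.w f) < h f

lemma w_ne (f : Fin F) : N.w f ≠ 0 := by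
  intro h
  have := (N.ch f).hn
  simp [h] at this

lemma norm_w_pos (f : Fin F) : 0 < ‖N.w f‖ := norm_pos_iff.2 (N.w_ne f)

lemma inner_pt (f : Fin F) (s : ℝ) (y : ℝ × ℝ) : inner ℝ (N.pt f s y) (N.w f) = s := by
  simp [pt, inner_add_left, inner_smul_left, (N.ch f).hn, (N.ch f).hp, (N.ch f).hq]

lemma inner_pt' (f g : Fin F) (s : ℝ) (y : ℝ × ℝ) : inner ℝ (N.pt f s y) (N.w g) =
    s * inner ℝ (N.ch f).n (N.w g) + y.1 * inner ℝ (N.ch f).p (N.w g)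
      + y.2 * inner ℝ (N.ch f).q (N.w g) := by
  simp [pt, inner_add_left, inner_smul_left]

lemma P_closed (h : Fin F → ℝ) : IsClosed (N.P h) := by
  simp only [P, Set.ofPred_forall]
  exact isClosed_iInter fun f => isClosed_le (by fun_prop) continuous_const

lemma P_sub (h : Fin F → ℝ) : N.P h ⊆ Metric.closedBall 0 (N.C * ∑ f, |h f|) := by
  intro x hx
  rw [mem_closedBall_zero_iff]
  exact N.bdd h x hx

lemma P_compact (h : Fin F → ℝ) : IsCompact (N.P h) :=
  (isCompact_closedBall _ _).of_isClosed_subset (N.P_closed h) (N.P_sub h)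

lemma Sl_closed (f : Fin F) (h : Fin F → ℝ) : IsClosed (N.Sl f h) := by
  apply (N.P_closed h).preimage
  unfold pt
  fun_prop

lemma Sl_sub (f : Fin F) (h : Fin F → ℝ) : N.Sl f h ⊆ Metric.closedBall 0 (N.C * ∑ f, |h f|) := by
  intro y hy
  rw [mem_closedBall_zero_iff, Prod.norm_def]
  have := N.bdd h _ hy
  exact max_le (((N.ch f).ha _ _ _).trans this) (((N.ch f).hb _ _ _).trans this)

lemma eventually_bound (h₀ : Fin F → ℝ) :
    ∀ᶠ h : Fin F → ℝ in nhds h₀, N.C * ∑ f, |h f| ≤ N.C * ∑ f, |h₀ f| + 1 := by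
  have : Continuous fun h : Fin F → ℝ => N.C * ∑ f, |h f| := by fun_prop
  filter_upwards [this.continuousAt.eventually_lt (continuousAt_const (y := N.C * ∑ f, |h₀ f| + 1)) (by linarith)]
    with h hh using hh.le

lemma V_cont : Continuous N.V := by
  rw [continuous_iff_continuousAt]
  intro h₀
  have := cont_tool (volume : Measure E3) (fun g h x => inner ℝ x (N.w g) - h g)
    (fun g h => by fun_prop) (fun g x => by fun_prop) h₀
    (Metric.closedBall 0 (N.C * ∑ f, |h₀ f| + 1)) measurableSet_closedBall
    measure_closedBall_lt_top.ne (by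
      filter_upwards [N.eventually_bound h₀] with h hh
      refine Set.Subset.trans ?_ ((N.P_sub h).trans (Metric.closedBall_subset_closedBall hh))
      intro x hx g
      have := hx g
      linarith) (by
      intro g
      have := null_level (volume : Measure E3) (innerₛₗ ℝ (N.w g)) (by
        intro h
        have := LinearMap.congr_fun h (N.w g)
        simp at this
        exact N.w_ne g this) (h₀ g)
      rw [measure_eq_zero_iff_ae_notMem] at this
      filter_upwards [this] with x hx
      left
      simp [real_inner_comm] at hx
      rw [sub_ne_zero]
      rw [real_inner_comm] at hx
      simpa [real_inner_comm] using hx)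
  simp only [sub_nonpos] at this
  exact this

lemma S_nonneg (f : Fin F) (h : Fin F → ℝ) : 0 ≤ N.S f h :=
  mul_nonneg (inv_nonneg.2 (norm_nonneg _)) measureReal_nonneg

lemma S_contAt (f : Fin F) {h₀ : Fin F → ℝ} (hF : N.Feas h₀) : ContinuousAt (N.S f) h₀ := by
  have := cont_tool (volume : Measure (ℝ × ℝ))
    (fun g h y => inner ℝ (N.pt f (h f) y) (N.w g) - h g)
    (fun g h => by unfold pt; fun_prop) (fun g x => by unfold pt; fun_prop) h₀
    (Metric.closedBall 0 (N.C * ∑ f, |h₀ f| + 1)) measurableSet_closedBall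
    measure_closedBall_lt_top.ne (by
      filter_upwards [N.eventually_bound h₀] with h hh
      refine Set.Subset.trans ?_ ((N.Sl_sub f h).trans (Metric.closedBall_subset_closedBall hh))
      intro x hx g
      have := hx g
      linarith) (by
      intro g
      by_cases hfg : f = g
      · subst hfg
        filter_upwards with y
        right
        intro h
        rw [inner_pt, sub_self]
      by_cases hpq : inner ℝ (N.ch f).p (N.w g) = 0 ∧ inner ℝ (N.ch f).q (N.w g) = 0
      · have hz := (N.ch f).perp _ hpq.1 hpq.2
        set c : ℝ := inner ℝ (N.ch f).n (N.w g) with hc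
        have hc0 : c < 0 := by
          by_contra hcc
          exact N.npar f g hfg c (not_lt.1 hcc) hz
        filter_upwards with y
        left
        obtain ⟨x, hx⟩ := hF
        have h1 := hx f
        have h2 := hx g
        rw [hz, inner_smul_right] at h2 ⊢
        rw [inner_pt]
        have : c * h₀ f < c * inner ℝ x (N.w f) := mul_lt_mul_of_neg_left h1 hc0
        apply ne_of_lt
        linarith
      · have := null_level (volume : Measure (ℝ × ℝ))
          ((inner ℝ (N.ch f).p (N.w g) : ℝ) • LinearMap.fst ℝ ℝ ℝ +
            (inner ℝ (N.ch f).q (N.w g) : ℝ) • LinearMap.snd ℝ ℝ ℝ) (by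
          intro h
          apply hpq
          constructor
          · have := LinearMap.congr_fun h (1, 0)
            simpa using this
          · have := LinearMap.congr_fun h (0, 1)
            simpa using this) (h₀ g - h₀ f * inner ℝ (N.ch f).n (N.w g))
        rw [measure_eq_zero_iff_ae_notMem] at this
        filter_upwards [this] with y hy
        left
        intro h0
        apply hy
        rw [inner_pt'] at h0
        simp only [LinearMap.add_apply, LinearMap.smul_apply, LinearMap.fst_apply,
          LinearMap.snd_apply, smul_eq_mul]
        linarith)
  have h2 := this.const_mul ‖N.w f‖⁻¹
  simp only [sub_nonpos] at h2
  exact h2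

lemma feas_open : IsOpen {h | N.Feas h} := by
  have : {h | N.Feas h} = ⋃ x : E3, {h : Fin F → ℝ | ∀ f, inner ℝ x (N.w f) < h f} := by
    ext h; simp [Feas]
  rw [this]
  apply isOpen_iUnion
  intro x
  simp only [Set.ofPred_forall]
  exact isOpen_iInter_of_finite fun f => isOpen_lt continuous_const (continuous_apply f)

lemma V_update (f : Fin F) (h : Fin F → ℝ) (s : ℝ) :
    IntegrableOn (fun σ => N.S f (Function.update h f σ)) (Set.Iic s) ∧
    N.V (Function.update h f s) = ∫ σ in Set.Iic s, N.S f (Function.update h f σ) := by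
  set m : ℝ → ENNReal := fun σ => volume (N.Sl f (Function.update h f σ)) with hm
  have hmm : Measurable m := by
    have hcl : IsClosed {z : ℝ × (ℝ × ℝ) | z.2 ∈ N.Sl f (Function.update h f z.1)} := by
      have : {z : ℝ × (ℝ × ℝ) | z.2 ∈ N.Sl f (Function.update h f z.1)} =
          ⋂ g, {z : ℝ × (ℝ × ℝ) | inner ℝ (N.pt f z.1 z.2) (N.w g) ≤ Function.update h f z.1 g} := by
        ext z; simp [Sl, P]
      rw [this]
      apply isClosed_iInter
      intro g
      apply isClosed_le
      · unfold pt; fun_prop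
      · have : Continuous fun σ : ℝ => Function.update h f σ := continuous_const.update f continuous_id
        exact (continuous_apply g).comp (this.comp continuous_fst)
    exact measurable_measure_prodMk_left hcl.measurableSet
  have e1 : volume (N.P (Function.update h f s)) =
      ENNReal.ofReal ‖N.w f‖⁻¹ * ∫⁻ σ in Set.Iic s, m σ := by
    rw [(N.ch f).vol _ (N.P_closed _).measurableSet, ← lintegral_indicator measurableSet_Iic]
    congr 1
    apply lintegral_congr
    intro σ
    by_cases hs : σ ≤ s
    · rw [Set.indicator_of_mem (show σ ∈ Set.Iic s from hs)]
      simp only [hm]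
      congr 1
      ext y
      simp only [Sl, P, Set.mem_ofPred_eq, Function.update_self]
      apply forall_congr'
      intro g
      by_cases hg : g = f
      · subst hg
        have := N.inner_pt g σ y
        rw [this]
        simp only [pt] at this
        simp [this, hs]
      · simp [Function.update_of_ne hg, pt]
    · rw [Set.indicator_of_notMem (show σ ∉ Set.Iic s from hs)]
      convert measure_empty (μ := (volume : Measure (ℝ × ℝ)))
      rw [Set.eq_empty_iff_forall_notMem]
      intro y hy
      have h1 := hy f
      have h2 := N.inner_pt f σ y
      simp only [pt] at h2
      rw [h2, Function.update_self] at h1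
      exact hs h1
  have hfin : ∫⁻ σ in Set.Iic s, m σ ≠ ⊤ := by
    intro ht
    rw [ht, ENNReal.mul_top (by simpa using N.w_ne f)] at e1
    exact (N.P_compact _).measure_lt_top.ne e1
  have hi : IntegrableOn (fun σ => (m σ).toReal) (Set.Iic s) :=
    integrable_toReal_of_lintegral_ne_top hmm.aemeasurable hfin
  refine ⟨hi.const_mul _, ?_⟩
  simp only [V, S, measureReal_def]
  rw [e1, integral_const_mul, ENNReal.toReal_mul, ENNReal.toReal_ofReal (by positivity)]
  congr 1
  rw [integral_toReal hmm.aemeasurable (ae_lt_top hmm hfin)]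

lemma V_sub (f : Fin F) (h : Fin F → ℝ) (s t : ℝ) :
    N.V (Function.update h f t) - N.V (Function.update h f s) =
      ∫ σ in s..t, N.S f (Function.update h f σ) := by
  rw [(N.V_update f h s).2, (N.V_update f h t).2,
    intervalIntegral.integral_Iic_sub_Iic (N.V_update f h s).1 (N.V_update f h t).1]

lemma V_partial (f : Fin F) (h : Fin F → ℝ) (s : ℝ) (hF : N.Feas (Function.update h f s)) :
    HasDerivAt (fun t => N.V (Function.update h f t)) (N.S f (Function.update h f s)) s := by
  have hu : Continuous fun σ : ℝ => Function.update h f σ := continuous_const.update f continuous_id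
  have hca : ContinuousAt (fun σ => N.S f (Function.update h f σ)) s :=
    ContinuousAt.comp (f := fun σ : ℝ => Function.update h f σ) (N.S_contAt f hF) hu.continuousAt
  have hint : ∀ a b, IntervalIntegrable (fun σ => N.S f (Function.update h f σ)) volume a b := by
    intro a b
    rw [intervalIntegrable_iff]
    apply (N.V_update f h (max a b)).1.mono_set
    intro x hx
    exact hx.2
  have := intervalIntegral.integral_hasDerivAt_right (hint (s - 1) s)
    ⟨Set.Iic (s + 1), Iic_mem_nhds (by linarith), (N.V_update f h (s + 1)).1.aestronglyMeasurable⟩ hca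
  have h2 := this.const_add (N.V (Function.update h f (s - 1)))
  have e : (fun t => N.V (Function.update h f t)) = fun x => N.V (Function.update h f (s - 1)) +
      ∫ x in (s - 1)..x, N.S f (Function.update h f x) := by
    funext t
    rw [← N.V_sub]; ring
  rw [e]
  exact h2

end Fan

namespace Fan
open scoped Pointwise
variable {F : ℕ} (N : Fan F)

lemma S_intervalIntegrable (f : Fin F) (h : Fin F → ℝ) (a b : ℝ) :
    IntervalIntegrable (fun σ => N.S f (Function.update h f σ)) volume a b := by
  rw [intervalIntegrable_iff]
  apply (N.V_update f h (max a b)).1.mono_set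
  intro x hx
  exact hx.2

lemma V_dir_step (f : Fin F) {h d : Fin F → ℝ} (hF : N.Feas h) (hdf : d f = 0) (c : ℝ) :
    HasDerivAt (fun t : ℝ => N.V (Function.update (h + t • d) f (h f + t * c)) - N.V (h + t • d))
      (N.S f h * c) 0 := by
  have key : ∀ t : ℝ, N.V (Function.update (h + t • d) f (h f + t * c)) - N.V (h + t • d) =
      ∫ σ in (h f)..(h f + t * c), N.S f (Function.update (h + t • d) f σ) := by
    intro t
    rw [← N.V_sub]
    congr 2
    rw [eq_comm, Function.update_eq_self_iff]
    simp [hdf]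
  rw [hasDerivAt_iff_isLittleO, Asymptotics.isLittleO_iff]
  intro ε hε
  obtain ⟨δ, hδ, hS⟩ := Metric.continuousAt_iff.1 (N.S_contAt f hF) (ε / (|c| + 1)) (by positivity)
  set M : ℝ := |c| + ∑ g, |d g| + 1 with hM
  have hsum : 0 ≤ ∑ g, |d g| := Finset.sum_nonneg fun g _ => abs_nonneg _
  have hMpos : 0 < M := by positivity
  filter_upwards [Metric.ball_mem_nhds (0 : ℝ) (show 0 < δ / M by positivity)] with t ht
  rw [mem_ball_zero_iff, Real.norm_eq_abs, lt_div_iff₀ hMpos] at ht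
  have k0 : N.V (Function.update (h + (0:ℝ) • d) f (h f + 0 * c)) - N.V (h + (0:ℝ) • d) = 0 := by
    rw [key]; simp
  rw [k0, key t]
  simp only [sub_zero, smul_eq_mul]
  have e : (∫ σ in (h f)..(h f + t * c), N.S f (Function.update (h + t • d) f σ)) - t * (N.S f h * c) =
      ∫ σ in (h f)..(h f + t * c), (N.S f (Function.update (h + t • d) f σ) - N.S f h) := by
    rw [intervalIntegral.integral_sub (N.S_intervalIntegrable _ _ _ _) intervalIntegrable_const]
    simp; ring
  rw [e]
  have := intervalIntegral.norm_integral_le_of_norm_le_const (a := h f) (b := h f + t * c)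
    (f := fun σ => N.S f (Function.update (h + t • d) f σ) - N.S f h) (C := ε / (|c| + 1)) (by
      intro σ hσ
      apply le_of_lt
      rw [← dist_eq_norm]
      apply hS
      rw [dist_pi_lt_iff hδ]
      intro g
      by_cases hg : g = f
      · subst hg
        rw [Function.update_self, Real.dist_eq]
        have h1 : |σ - h g| ≤ |t * c| := by
          have := Set.abs_sub_left_of_mem_uIcc (Set.uIoc_subset_uIcc hσ)
          simpa using this
        rw [abs_mul] at h1
        have : |t| * |c| ≤ |t| * M := by
          apply mul_le_mul_of_nonneg_left _ (abs_nonneg t)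
          linarith
        linarith
      · rw [Function.update_of_ne hg, Real.dist_eq]
        simp only [Pi.add_apply, Pi.smul_apply, smul_eq_mul, add_sub_cancel_left, abs_mul]
        have h2 : |d g| ≤ ∑ g, |d g| :=
          Finset.single_le_sum (f := fun g => |d g|) (fun g _ => abs_nonneg _) (Finset.mem_univ g)
        have : |t| * |d g| ≤ |t| * M := by
          apply mul_le_mul_of_nonneg_left _ (abs_nonneg t)
          have := abs_nonneg c
          linarith
        linarith)
  refine this.trans ?_
  rw [add_sub_cancel_left, abs_mul, Real.norm_eq_abs]
  have : ε / (|c| + 1) * |c| ≤ ε := by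
    rw [div_mul_eq_mul_div, div_le_iff₀ (by positivity)]
    nlinarith [abs_nonneg c]
  calc ε / (|c| + 1) * (|t| * |c|) = (ε / (|c| + 1) * |c|) * |t| := by ring
    _ ≤ ε * |t| := by gcongr

lemma V_dir {h : Fin F → ℝ} (d : Fin F → ℝ) (hF : N.Feas h) :
    HasDerivAt (fun t : ℝ => N.V (h + t • d)) (∑ f, N.S f h * d f) 0 := by
  have key : ∀ s : Finset (Fin F), HasDerivAt
      (fun t : ℝ => N.V (h + t • (fun f => if f ∈ s then d f else 0))) (∑ f ∈ s, N.S f h * d f) 0 := by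
    intro s
    induction s using Finset.induction_on with
    | empty =>
      simp only [Finset.notMem_empty, if_false, Finset.sum_empty]
      have : (fun t : ℝ => N.V (h + t • (fun _ : Fin F => (0:ℝ)))) = fun _ => N.V h := by
        funext t
        congr 1
        ext f; simp
      rw [this]
      exact hasDerivAt_const _ _
    | insert f s hf ih =>
      rw [Finset.sum_insert hf]
      have h1 := N.V_dir_step f (d := fun f => if f ∈ s then d f else 0) hF (by simp [hf]) (d f)
      have h2 := h1.add ih
      have e : (fun t : ℝ => N.V (h + t • (fun g => if g ∈ insert f s then d g else 0))) =
          (fun t : ℝ => N.V (Function.update (h + t • fun f => if f ∈ s then d f else 0) f (h f + t * d f)) - N.V (h + t • fun f => if f ∈ s then d f else 0)) +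
          fun t : ℝ => N.V (h + t • fun f => if f ∈ s then d f else 0) := by
        funext t
        simp only [Pi.add_apply, sub_add_cancel]
        congr 1
        ext g
        by_cases hg : g = f
        · subst hg; simp
        · simp [Function.update_of_ne hg, hg]
      rw [e]
      exact h2
  have := key Finset.univ
  simpa using this

lemma P_smul (h : Fin F → ℝ) {r : ℝ} (hr : 0 < r) : N.P (r • h) = r • N.P h := by
  ext x
  rw [Set.mem_smul_set_iff_inv_smul_mem₀ hr.ne']
  simp only [P, Set.mem_ofPred_eq, inner_smul_left, Pi.smul_apply, smul_eq_mul]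
  apply forall_congr'
  intro f
  rw [conj_trivial, inv_mul_le_iff₀ hr]

lemma V_smul (h : Fin F → ℝ) {r : ℝ} (hr : 0 < r) : N.V (r • h) = r ^ 3 * N.V h := by
  rw [V, P_smul N h hr, measureReal_def, Measure.addHaar_smul, ENNReal.toReal_mul,
    ENNReal.toReal_ofReal (abs_nonneg _)]
  simp only [finrank_euclideanSpace, Fintype.card_fin]
  rw [abs_of_pos (by positivity)]
  rfl

lemma S_smul (f : Fin F) (h : Fin F → ℝ) {r : ℝ} (hr : 0 < r) : N.S f (r • h) = r ^ 2 * N.S f h := by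
  have : N.Sl f (r • h) = r • N.Sl f h := by
    ext y
    rw [Set.mem_smul_set_iff_inv_smul_mem₀ hr.ne']
    simp only [Sl, Set.mem_ofPred_eq]
    rw [N.P_smul h hr, Set.mem_smul_set_iff_inv_smul_mem₀ hr.ne']
    have : r⁻¹ • N.pt f ((r • h) f) y = N.pt f (h f) (r⁻¹ • y) := by
      simp only [pt, Pi.smul_apply, smul_eq_mul, Prod.smul_fst, Prod.smul_snd, smul_add, smul_smul]
      rw [inv_mul_cancel_left₀ hr.ne']
    rw [this]
  rw [S, this, measureReal_def, Measure.addHaar_smul, ENNReal.toReal_mul,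
    ENNReal.toReal_ofReal (abs_nonneg _)]
  simp only [Module.finrank_prod, Module.finrank_self]
  rw [abs_of_pos (by positivity), S, measureReal_def]
  ring

lemma euler {h : Fin F → ℝ} (hF : N.Feas h) : ∑ f, N.S f h * h f = 3 * N.V h := by
  have h1 := N.V_dir h hF
  have h2 : HasDerivAt (fun t : ℝ => (1 + t) ^ 3 * N.V h) (3 * N.V h) 0 := by
    have := (((hasDerivAt_id (0:ℝ)).const_add 1).pow 3).mul_const (N.V h)
    have e : 3 * N.V h = ((3 : ℕ) : ℝ) * (1 + id 0) ^ (3 - 1) * 1 * N.V h := by norm_num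
    rw [e]
    exact this
  have h3 : HasDerivAt (fun t : ℝ => N.V (h + t • h)) (3 * N.V h) 0 := by
    apply h2.congr_of_eventuallyEq
    filter_upwards [Ioi_mem_nhds (show (-1:ℝ) < 0 by norm_num)] with t ht
    have ht' : -1 < t := ht
    rw [← N.V_smul h (show 0 < 1 + t by linarith), add_smul, one_smul]
  exact h1.unique h3

/-- effect of a translation on the support numbers. -/
def tr (t : E3) : Fin F → ℝ := fun f => inner ℝ t (N.w f)

lemma mem_P_tr (h : Fin F → ℝ) (t x : E3) : x + t ∈ N.P (h + N.tr t) ↔ x ∈ N.P h := by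
  simp [P, tr, inner_add_left]

lemma P_tr (h : Fin F → ℝ) (t : E3) : N.P (h + N.tr t) = (fun x => x + t) '' N.P h := by
  ext x
  constructor
  · intro hx
    refine ⟨x - t, ?_, by simp⟩
    rw [← N.mem_P_tr h t]; simpa using hx
  · rintro ⟨y, hy, rfl⟩
    exact (N.mem_P_tr h t y).2 hy

lemma V_tr (h : Fin F → ℝ) (t : E3) : N.V (h + N.tr t) = N.V h := by
  have : N.P h = (fun x => x + t) ⁻¹' N.P (h + N.tr t) := by
    ext x; exact (N.mem_P_tr h t x).symm
  rw [V, V, this, measureReal_def, measureReal_def, measure_preimage_add_right]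

lemma Feas_tr {h : Fin F → ℝ} (hF : N.Feas h) (t : E3) : N.Feas (h + N.tr t) := by
  obtain ⟨x, hx⟩ := hF
  refine ⟨x + t, fun f => ?_⟩
  have := hx f
  simp only [tr, inner_add_left, Pi.add_apply]
  linarith

lemma S_tr (f : Fin F) {h : Fin F → ℝ} (hF : N.Feas h) (t : E3) : N.S f (h + N.tr t) = N.S f h := by
  have h1 := N.V_dir (Pi.single f 1) hF
  have h2 := N.V_dir (Pi.single f 1) (N.Feas_tr hF t)
  have e : (fun s : ℝ => N.V (h + N.tr t + s • Pi.single f 1)) =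
      fun s : ℝ => N.V (h + s • Pi.single f 1) := by
    funext s
    rw [add_right_comm, V_tr]
  rw [e] at h2
  have := h2.unique h1
  simpa [Pi.single_apply] using this

def mid (h h' : Fin F → ℝ) : Fin F → ℝ := fun f => (h f + h' f) / 2

lemma S_bm (f : Fin F) (h h' : Fin F → ℝ) : N.S f h * N.S f h' ≤ N.S f (mid h h') ^ 2 := by
  have b : ∀ h, Bornology.IsBounded (N.Sl f h) := fun h =>
    Metric.isBounded_closedBall.subset (N.Sl_sub f h)
  have := bm_two (N.Sl_closed f h).measurableSet (N.Sl_closed f h').measurableSet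
    (N.Sl_closed f (mid h h')).measurableSet (b _) (b _) (b _) (by
      intro x hx y hy g
      have h1 := hx g
      have h2 := hy g
      rw [inner_pt'] at h1 h2 ⊢
      simp only [mid] at *
      linarith)
  simp only [S, mul_pow]
  calc _ = ‖N.w f‖⁻¹ ^ 2 * (volume.real (N.Sl f h) * volume.real (N.Sl f h')) := by ring
    _ ≤ _ := by gcongr

lemma Feas_of_V_pos {h : Fin F → ℝ} (hV : 0 < N.V h) : N.Feas h := by
  by_contra hF
  have : volume (N.P h) = 0 := by
    refine measure_mono_null (t := ⋃ g, {x | innerₛₗ ℝ (N.w g) x = h g}) ?_ ?_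
    · intro x hx
      by_contra hxx
      apply hF
      refine ⟨x, fun g => lt_of_le_of_ne (hx g) ?_⟩
      intro he
      apply hxx
      rw [Set.mem_iUnion]
      refine ⟨g, ?_⟩
      simp only [Set.mem_ofPred_eq, innerₛₗ_apply_apply]
      rw [real_inner_comm]; exact he
    · rw [measure_iUnion_null_iff]
      intro g
      apply null_level
      intro h
      have := LinearMap.congr_fun h (N.w g)
      simp at this
      exact N.w_ne g this
  rw [V, measureReal_def, this] at hV
  simp at hV

lemma V_pos {h : Fin F → ℝ} (hF : N.Feas h) : 0 < N.V h := by
  obtain ⟨x, hx⟩ := hF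
  have ho : IsOpen {x : E3 | ∀ f, inner ℝ x (N.w f) < h f} := by
    simp only [Set.ofPred_forall]
    exact isOpen_iInter_of_finite fun f => isOpen_lt (by fun_prop) continuous_const
  apply ENNReal.toReal_pos _ (N.P_compact h).measure_lt_top.ne
  apply ne_of_gt
  exact (ho.measure_pos volume ⟨x, hx⟩).trans_le (measure_mono fun y hy g => (hy g).le)

lemma Feas_of_interior {h : Fin F → ℝ} (hI : (interior (N.P h)).Nonempty) : N.Feas h := by
  apply N.Feas_of_V_pos
  apply ENNReal.toReal_pos _ (N.P_compact h).measure_lt_top.ne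
  exact ((isOpen_interior.measure_pos volume hI).trans_le (measure_mono interior_subset)).ne'

lemma interior_of_Feas {h : Fin F → ℝ} (hF : N.Feas h) : (interior (N.P h)).Nonempty := by
  obtain ⟨x, hx⟩ := hF
  have ho : IsOpen {x : E3 | ∀ f, inner ℝ x (N.w f) < h f} := by
    simp only [Set.ofPred_forall]
    exact isOpen_iInter_of_finite fun f => isOpen_lt (by fun_prop) continuous_const
  exact ⟨x, interior_maximal (fun y hy g => (hy g).le) ho hx⟩

end Fan

namespace Fan
variable {F : ℕ} (N : Fan F)

lemma fin_nonempty {F : ℕ} (N : Fan F) : Nonempty (Fin F) := by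
  by_contra hne
  rw [not_nonempty_iff] at hne
  have := N.bdd 0 (EuclideanSpace.single 0 1) (fun f => hne.elim f)
  simp at this
  linarith

lemma sum_tr {A : Fin F → ℝ} (hcl : ∑ f, A f • N.w f = 0) (t : E3) :
    ∑ f, A f * N.tr t f = 0 := by
  have : ∑ f, A f * N.tr t f = inner ℝ t (∑ f, A f • N.w f) := by
    rw [inner_sum]
    apply Finset.sum_congr rfl
    intro f _
    rw [inner_smul_right, tr]
  rw [this, hcl, inner_zero_right]

lemma exists_h {A : Fin F → ℝ} (hA : ∀ f, 0 < A f) (hcl : ∑ f, A f • N.w f = 0) :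
    ∃ h, N.Feas h ∧ ∀ f, N.S f h = A f := by
  haveI := N.fin_nonempty
  set K : Set (Fin F → ℝ) := {h | (∀ f, 0 ≤ h f) ∧ ∑ f, A f * h f = 1} with hK
  have hKc : IsCompact K := by
    apply (isCompact_Icc (a := (0 : Fin F → ℝ)) (b := fun f => 1 / A f)).of_isClosed_subset
    · have h1 : IsClosed {h : Fin F → ℝ | ∀ f, 0 ≤ h f} := by
        simp only [Set.ofPred_forall]
        exact isClosed_iInter fun f => isClosed_le continuous_const (continuous_apply f)
      have h2 : IsClosed {h : Fin F → ℝ | ∑ f, A f * h f = 1} :=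
        isClosed_eq (by fun_prop) continuous_const
      exact h1.inter h2
    · rintro h ⟨h1, h2⟩
      refine ⟨h1, fun f => ?_⟩
      rw [le_div_iff₀ (hA f), mul_comm, ← h2]
      exact Finset.single_le_sum (f := fun f => A f * h f)
        (fun g _ => mul_nonneg (hA g).le (h1 g)) (Finset.mem_univ f)
  have hsA : 0 < ∑ f, A f := Finset.sum_pos (fun f _ => hA f) Finset.univ_nonempty
  have hk0 : (fun _ => 1 / ∑ f, A f) ∈ K := by
    refine ⟨fun f => by positivity, ?_⟩
    rw [← Finset.sum_mul]
    field_simp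
  obtain ⟨h0, hh0, hmax⟩ := hKc.exists_isMaxOn ⟨_, hk0⟩ N.V_cont.continuousOn
  have hV0 : 0 < N.V h0 := by
    refine lt_of_lt_of_le (N.V_pos ⟨0, fun f => ?_⟩) (hmax hk0)
    rw [inner_zero_left]; positivity
  obtain ⟨x0, hx0⟩ := N.Feas_of_V_pos hV0
  set h := h0 + N.tr (-x0) with hh
  have hpos : ∀ f, 0 < h f := by
    intro f
    have := hx0 f
    simp only [hh, Pi.add_apply, tr, inner_neg_left]
    linarith
  have hsum : ∑ f, A f * h f = 1 := by
    simp only [hh, Pi.add_apply, mul_add, Finset.sum_add_distrib, N.sum_tr hcl, add_zero]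
    exact hh0.2
  have hVh : N.V h = N.V h0 := N.V_tr _ _
  have hF : N.Feas h := N.Feas_of_V_pos (hVh ▸ hV0)
  have key : ∀ f g, N.S f h / A f = N.S g h / A g := by
    intro f g
    set d : Fin F → ℝ := Pi.single f (1 / A f) - Pi.single g (1 / A g) with hd
    have hdA : ∑ k, A k * d k = 0 := by
      simp [hd, mul_sub, Finset.sum_sub_distrib, Pi.single_apply, (hA _).ne']
    have hmem : ∀ᶠ t : ℝ in nhds 0, ∀ k, 0 < (h + t • d) k := by
      rw [Filter.eventually_all]
      intro k
      have hc : Continuous fun t : ℝ => (h + t • d) k := by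
        simp only [Pi.add_apply, Pi.smul_apply]; fun_prop
      apply continuousAt_const.eventually_lt hc.continuousAt
      simpa using hpos k
    have hloc : IsLocalMax (fun t : ℝ => N.V (h + t • d)) 0 := by
      filter_upwards [hmem] with t ht
      simp only [zero_smul, add_zero]
      rw [hVh]
      apply hmax
      refine ⟨fun k => (ht k).le, ?_⟩
      simp only [Pi.add_apply, Pi.smul_apply, smul_eq_mul, mul_add, Finset.sum_add_distrib, hsum]
      have : ∑ k, A k * (t * d k) = t * ∑ k, A k * d k := by
        rw [Finset.mul_sum]; apply Finset.sum_congr rfl; intros; ring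
      rw [this, hdA]; simp
    have h0 := hloc.hasDerivAt_eq_zero (N.V_dir d hF)
    simp [hd, mul_sub, Finset.sum_sub_distrib, Pi.single_apply] at h0
    rw [div_eq_mul_inv, div_eq_mul_inv]
    linarith
  obtain ⟨f0⟩ := N.fin_nonempty
  set l := N.S f0 h / A f0 with hl
  have hS : ∀ f, N.S f h = l * A f := by
    intro f
    rw [hl, ← key f f0, div_mul_cancel₀ _ (hA f).ne']
  have hlpos : 0 < l := by
    have h1 := N.euler hF
    simp only [hS] at h1
    have : ∑ f, l * A f * h f = l := by
      have : ∑ f, l * A f * h f = l * ∑ f, A f * h f := by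
        rw [Finset.mul_sum]; apply Finset.sum_congr rfl; intros; ring
      rw [this, hsum, mul_one]
    rw [this] at h1
    rw [h1, hVh]; positivity
  have hr : 0 < Real.sqrt (1 / l) := Real.sqrt_pos.2 (by positivity)
  refine ⟨Real.sqrt (1 / l) • h, ?_, ?_⟩
  · apply N.Feas_of_V_pos
    rw [N.V_smul h hr]
    have := N.V_pos hF
    positivity
  · intro f
    rw [N.S_smul f h hr, Real.sq_sqrt (by positivity), hS]
    field_simp

end Fan

namespace Fan
variable {F : ℕ} (N : Fan F)

/-- points on the segment from `h₁` to `h₂` at parameter `2^{-n}`. -/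
def seg (h₁ h₂ : Fin F → ℝ) (n : ℕ) : Fin F → ℝ := h₁ + ((1/2:ℝ)^n) • (h₂ - h₁)

lemma seg_apply (h₁ h₂ : Fin F → ℝ) (n : ℕ) (f : Fin F) :
    seg h₁ h₂ n f = h₁ f + (1/2:ℝ)^n * (h₂ f - h₁ f) := by simp [seg]

lemma seg_zero (h₁ h₂ : Fin F → ℝ) : seg h₁ h₂ 0 = h₂ := by
  ext f; simp [seg]

lemma mid_seg (h₁ h₂ : Fin F → ℝ) (n : ℕ) : mid h₁ (seg h₁ h₂ n) = seg h₁ h₂ (n + 1) := by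
  ext f; simp only [mid, seg_apply]; ring

lemma seg_one (h₁ h₂ : Fin F → ℝ) : seg h₁ h₂ 1 = mid h₁ h₂ := by
  rw [← mid_seg, seg_zero]

lemma seg_ge {h₁ h₂ : Fin F → ℝ} (n : ℕ) (f : Fin F) : min (h₁ f) (h₂ f) ≤ seg h₁ h₂ n f := by
  rw [seg_apply]
  have h1 : (1/2:ℝ)^n ≤ 1 := pow_le_one₀ (by norm_num) (by norm_num)
  have h0 : 0 ≤ (1/2:ℝ)^n := by positivity
  rcases le_total (h₁ f) (h₂ f) with h | h
  · rw [min_eq_left h]; nlinarith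
  · rw [min_eq_right h]; nlinarith

lemma Feas_of_pos {h : Fin F → ℝ} (hp : ∀ f, 0 < h f) : N.Feas h :=
  ⟨0, fun f => by rw [inner_zero_left]; exact hp f⟩

lemma seg_pos {h₁ h₂ : Fin F → ℝ} (p₁ : ∀ f, 0 < h₁ f) (p₂ : ∀ f, 0 < h₂ f) (n : ℕ) (f : Fin F) :
    0 < seg h₁ h₂ n f := lt_of_lt_of_le (lt_min (p₁ f) (p₂ f)) (seg_ge n f)

lemma S_seg_ge {A h₁ h₂ : Fin F → ℝ} (hA : ∀ f, 0 < A f)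
    (s₁ : ∀ f, N.S f h₁ = A f) (s₂ : ∀ f, N.S f h₂ = A f) (n : ℕ) (f : Fin F) : A f ≤ N.S f (seg h₁ h₂ n) := by
  induction n with
  | zero => rw [seg_zero, s₂]
  | succ n ih =>
    have h1 := N.S_bm f h₁ (seg h₁ h₂ n)
    rw [mid_seg, s₁] at h1
    have h2 := N.S_nonneg f (seg h₁ h₂ (n+1))
    have := hA f
    by_contra hlt
    push Not at hlt
    nlinarith

lemma seg_tendsto {h₁ h₂ : Fin F → ℝ} (p₁ : ∀ f, 0 < h₁ f) :
    Filter.Tendsto (fun n : ℕ => (2:ℝ)^n * (N.V (seg h₁ h₂ n) - N.V h₁)) Filter.atTop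
      (nhds (∑ f, N.S f h₁ * (h₂ f - h₁ f))) := by
  have h1 := (N.V_dir (h₂ - h₁) (N.Feas_of_pos p₁)).tendsto_slope_zero
  have h2 : Filter.Tendsto (fun n : ℕ => (1/2:ℝ)^n) Filter.atTop (nhdsWithin 0 {0}ᶜ) := by
    rw [tendsto_nhdsWithin_iff]
    refine ⟨tendsto_pow_atTop_nhds_zero_of_lt_one (by norm_num) (by norm_num), ?_⟩
    filter_upwards with n
    simp
  have h3 := h1.comp h2
  convert h3 using 2 with n
  · simp [seg, smul_eq_mul]
  · rfl

lemma V_le {A h₁ h₂ : Fin F → ℝ} (hA : ∀ f, 0 < A f) (p₁ : ∀ f, 0 < h₁ f) (p₂ : ∀ f, 0 < h₂ f)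
    (s₁ : ∀ f, N.S f h₁ = A f) (s₂ : ∀ f, N.S f h₂ = A f) : N.V h₁ ≤ N.V h₂ := by
  have e1 := N.euler (N.Feas_of_pos p₁)
  have e2 := N.euler (N.Feas_of_pos p₂)
  simp only [s₁] at e1
  simp only [s₂] at e2
  have t := N.seg_tendsto (h₂ := h₂) p₁
  simp only [s₁, mul_sub, Finset.sum_sub_distrib, e1, e2] at t
  have : N.V h₂ - N.V h₁ ≤ 3 * N.V h₂ - 3 * N.V h₁ := by
    apply ge_of_tendsto' t
    intro n
    have e3 := N.euler (N.Feas_of_pos (seg_pos p₁ p₂ n))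
    have e4 : ∑ f, A f * seg h₁ h₂ n f ≤ 3 * N.V (seg h₁ h₂ n) := by
      rw [← e3]
      apply Finset.sum_le_sum
      intro f _
      exact mul_le_mul_of_nonneg_right (N.S_seg_ge hA s₁ s₂ n f) (seg_pos p₁ p₂ n f).le
    have e5 : ∑ f, A f * seg h₁ h₂ n f = 3 * N.V h₁ + (1/2:ℝ)^n * (3 * N.V h₂ - 3 * N.V h₁) := by
      rw [← e1, ← e2, ← Finset.sum_sub_distrib, Finset.mul_sum, ← Finset.sum_add_distrib]
      apply Finset.sum_congr rfl
      intro f _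
      rw [seg_apply]; ring
    have h2 : (2:ℝ)^n * (1/2:ℝ)^n = 1 := by rw [← mul_pow]; norm_num
    have h3 : (0:ℝ) < 2^n := by positivity
    have h4 : (1/2:ℝ)^n * (N.V h₂ - N.V h₁) ≤ N.V (seg h₁ h₂ n) - N.V h₁ := by linarith
    calc N.V h₂ - N.V h₁ = 2^n * ((1/2:ℝ)^n * (N.V h₂ - N.V h₁)) := by
          rw [← mul_assoc, h2, one_mul]
      _ ≤ 2^n * (N.V (seg h₁ h₂ n) - N.V h₁) := by gcongr
      _ = _ := by ring
  linarith

lemma V_mid_pos {A h₁ h₂ : Fin F → ℝ} (hA : ∀ f, 0 < A f) (p₁ : ∀ f, 0 < h₁ f) (p₂ : ∀ f, 0 < h₂ f)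
    (s₁ : ∀ f, N.S f h₁ = A f) (s₂ : ∀ f, N.S f h₂ = A f) :
    N.V h₁ = N.V h₂ ∧ N.V (mid h₁ h₂) = N.V h₁ := by
  have hV : N.V h₁ = N.V h₂ := le_antisymm (N.V_le hA p₁ p₂ s₁ s₂) (N.V_le hA p₂ p₁ s₂ s₁)
  refine ⟨hV, ?_⟩
  have e1 := N.euler (N.Feas_of_pos p₁)
  have e2 := N.euler (N.Feas_of_pos p₂)
  simp only [s₁] at e1
  simp only [s₂] at e2
  have t := N.seg_tendsto (h₂ := h₂) p₁
  simp only [s₁, mul_sub, Finset.sum_sub_distrib, e1, e2, hV, sub_self] at t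
  have e5 : ∀ n, ∑ f, A f * seg h₁ h₂ n f = 3 * N.V h₁ := by
    intro n
    have : ∑ f, A f * seg h₁ h₂ n f = 3 * N.V h₁ + (1/2:ℝ)^n * (3 * N.V h₂ - 3 * N.V h₁) := by
      rw [← e1, ← e2, ← Finset.sum_sub_distrib, Finset.mul_sum, ← Finset.sum_add_distrib]
      apply Finset.sum_congr rfl
      intro f _
      rw [seg_apply]; ring
    rw [this, hV]; ring
  have hσ : ∀ f, N.S f (mid h₁ h₂) = A f := by
    intro f
    rw [← seg_one]
    apply le_antisymm _ (N.S_seg_ge hA s₁ s₂ 1 f)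
    set ρ : ℕ → ℝ := fun n => N.S f (seg h₁ h₂ n) / A f with hρ
    have hρ1 : ∀ n, 1 ≤ ρ n := fun n => by
      rw [hρ]; simp only []; rw [le_div_iff₀ (hA f), one_mul]; exact N.S_seg_ge hA s₁ s₂ n f
    have hlog : ∀ n, Real.log (ρ 1) ≤ 2^n * Real.log (ρ (n+1)) := by
      intro n
      induction n with
      | zero => simp
      | succ n ih =>
        refine ih.trans ?_
        have h1 := N.S_bm f h₁ (seg h₁ h₂ (n+1))
        rw [mid_seg, s₁] at h1
        have h2 : ρ (n+1) ≤ ρ (n+1+1) ^ 2 := by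
          simp only [hρ]
          rw [div_pow, div_le_div_iff₀ (hA f) (pow_pos (hA f) 2)]
          nlinarith [hA f]
        have h3 := Real.log_le_log (lt_of_lt_of_le one_pos (hρ1 _)) h2
        rw [Real.log_pow] at h3
        have : (0:ℝ) < 2^n := by positivity
        rw [pow_succ, mul_assoc]
        push_cast at h3
        gcongr
    have hm : 0 < min (h₁ f) (h₂ f) := lt_min (p₁ f) (p₂ f)
    have hlim : A f * Real.log (ρ 1) * min (h₁ f) (h₂ f) ≤ 0 := by
      have t' := (t.comp (Filter.tendsto_add_atTop_nat 1)).const_mul 3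
      rw [mul_zero] at t'
      apply ge_of_tendsto' t'
      intro n
      simp only [Function.comp]
      have e3 := N.euler (N.Feas_of_pos (seg_pos p₁ p₂ (n+1)))
      have e6 : ∑ g, (N.S g (seg h₁ h₂ (n+1)) - A g) * seg h₁ h₂ (n+1) g =
          3 * (N.V (seg h₁ h₂ (n+1)) - N.V h₂) := by
        simp only [sub_mul, Finset.sum_sub_distrib, e3, e5, hV]; ring
      have e7 : (N.S f (seg h₁ h₂ (n+1)) - A f) * seg h₁ h₂ (n+1) f ≤
          3 * (N.V (seg h₁ h₂ (n+1)) - N.V h₂) := by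
        rw [← e6]
        exact Finset.single_le_sum (f := fun g => (N.S g (seg h₁ h₂ (n+1)) - A g) * seg h₁ h₂ (n+1) g)
          (fun g _ => mul_nonneg (sub_nonneg.2 (N.S_seg_ge hA s₁ s₂ _ g)) (seg_pos p₁ p₂ _ g).le)
          (Finset.mem_univ f)
      have e8 : A f * Real.log (ρ (n+1)) ≤ N.S f (seg h₁ h₂ (n+1)) - A f := by
        have h1 := Real.log_le_sub_one_of_pos (lt_of_lt_of_le one_pos (hρ1 (n+1)))
        have h2 : A f * ρ (n+1) = N.S f (seg h₁ h₂ (n+1)) := by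
          simp only [hρ]; rw [mul_div_cancel₀ _ (hA f).ne']
        nlinarith [hA f]
      have hl0 : 0 ≤ Real.log (ρ (n+1)) := Real.log_nonneg (hρ1 _)
      have e9 : A f * Real.log (ρ (n+1)) * min (h₁ f) (h₂ f) ≤
          3 * (N.V (seg h₁ h₂ (n+1)) - N.V h₂) := by
        refine le_trans ?_ e7
        have := hA f
        apply mul_le_mul e8 (seg_ge _ f) hm.le
        exact sub_nonneg.2 (N.S_seg_ge hA s₁ s₂ _ f)
      have hl1 : 0 ≤ Real.log (ρ 1) := Real.log_nonneg (hρ1 _)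
      have h2n : (0:ℝ) < 2^n := by positivity
      have hAf := hA f
      have e10 := hlog n
      have e11 : 0 ≤ 3 * (N.V (seg h₁ h₂ (n+1)) - N.V h₂) := le_trans (by positivity) e9
      calc A f * Real.log (ρ 1) * min (h₁ f) (h₂ f)
          ≤ A f * (2^n * Real.log (ρ (n+1))) * min (h₁ f) (h₂ f) := by gcongr
        _ = 2^n * (A f * Real.log (ρ (n+1)) * min (h₁ f) (h₂ f)) := by ring
        _ ≤ 2^n * (3 * (N.V (seg h₁ h₂ (n+1)) - N.V h₂)) := by gcongr
        _ ≤ 2^n * (3 * (N.V (seg h₁ h₂ (n+1)) - N.V h₂)) * 2 := by nlinarith [mul_nonneg h2n.le e11]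
        _ = _ := by ring
    have hAf := hA f
    have hlog0 : Real.log (ρ 1) ≤ 0 := by
      by_contra hc
      push Not at hc
      have := mul_pos (mul_pos hAf hc) hm
      linarith
    have : ρ 1 ≤ 1 := by
      by_contra hc
      push Not at hc
      exact absurd (Real.log_pos hc) (not_lt.2 hlog0)
    simp only [hρ] at this
    rwa [div_le_iff₀ hAf, one_mul] at this
  have e3 := N.euler (N.Feas_of_pos (seg_pos p₁ p₂ 1))
  rw [seg_one] at e3
  simp only [hσ] at e3
  have := e5 1
  rw [seg_one, e3] at this
  linarith

lemma V_mid {A h₁ h₂ : Fin F → ℝ} (hA : ∀ f, 0 < A f) (f₁ : N.Feas h₁) (f₂ : N.Feas h₂)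
    (s₁ : ∀ f, N.S f h₁ = A f) (s₂ : ∀ f, N.S f h₂ = A f) :
    N.V h₁ = N.V h₂ ∧ N.V (mid h₁ h₂) = N.V h₁ := by
  obtain ⟨x₁, hx₁⟩ := id f₁
  obtain ⟨x₂, hx₂⟩ := id f₂
  have := N.V_mid_pos (h₁ := h₁ + N.tr (-x₁)) (h₂ := h₂ + N.tr (-x₂)) hA
    (fun f => by have := hx₁ f; simp only [Pi.add_apply, tr, inner_neg_left]; linarith)
    (fun f => by have := hx₂ f; simp only [Pi.add_apply, tr, inner_neg_left]; linarith)
    (fun f => by rw [N.S_tr f f₁, s₁]) (fun f => by rw [N.S_tr f f₂, s₂])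
  have e : mid (h₁ + N.tr (-x₁)) (h₂ + N.tr (-x₂)) = mid h₁ h₂ + N.tr ((1/2:ℝ) • (-x₁ + -x₂)) := by
    ext f
    simp only [mid, tr, Pi.add_apply, inner_smul_left, inner_add_left, conj_trivial]
    ring
  rw [e] at this
  simpa only [N.V_tr] using this

end Fan

namespace Fan
variable {F : ℕ} (N : Fan F)

lemma exists_pt (f : Fin F) (z : E3) : ∃ y, N.pt f (inner ℝ z (N.w f)) y = z := by
  set L : (ℝ × (ℝ × ℝ)) →ₗ[ℝ] E3 :=
    { toFun := fun u => N.pt f u.1 u.2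
      map_add' := by intro u v; simp only [pt, Prod.fst_add, Prod.snd_add, add_smul]; abel
      map_smul' := by
        intro c u
        simp only [pt, Prod.smul_fst, Prod.smul_snd, smul_eq_mul, mul_smul, smul_add,
          RingHom.id_apply] } with hL
  have hinj : Function.Injective L := by
    rw [← LinearMap.ker_eq_bot, LinearMap.ker_eq_bot']
    rintro ⟨s, a, b⟩ h
    have h' : N.pt f s (a, b) = 0 := h
    have h1 := N.inner_pt f s (a, b)
    rw [h', inner_zero_left] at h1
    have h2 := (N.ch f).ha s a b
    have h3 := (N.ch f).hb s a b
    have h4 : s • (N.ch f).n + a • (N.ch f).p + b • (N.ch f).q = 0 := h'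
    rw [h4, norm_zero] at h2 h3
    have h5 := abs_nonpos_iff.1 h2
    have h6 := abs_nonpos_iff.1 h3
    rw [← h1, h5, h6]; rfl
  have hsurj : Function.Surjective L := by
    rw [← LinearMap.injective_iff_surjective_of_finrank_eq_finrank]
    · exact hinj
    · simp
  obtain ⟨⟨s, y⟩, h⟩ := hsurj z
  have h' : N.pt f s y = z := h
  refine ⟨y, ?_⟩
  rw [← h', inner_pt]

lemma update_mid (h₁ h₂ : Fin F → ℝ) (f : Fin F) (x y : ℝ) :
    Function.update (mid h₁ h₂) f ((x + y) / 2) =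
      mid (Function.update h₁ f x) (Function.update h₂ f y) := by
  ext g
  by_cases hg : g = f
  · subst hg; simp [mid]
  · simp [mid, Function.update_of_ne hg]

lemma Feas_mid {h₁ h₂ : Fin F → ℝ} (f₁ : N.Feas h₁) (f₂ : N.Feas h₂) : N.Feas (mid h₁ h₂) := by
  obtain ⟨x, hx⟩ := f₁
  obtain ⟨y, hy⟩ := f₂
  refine ⟨(1/2:ℝ) • (x + y), fun f => ?_⟩
  have := hx f
  have := hy f
  simp only [mid, inner_smul_left, inner_add_left, conj_trivial]
  linarith

lemma update_cont (h : Fin F → ℝ) (f : Fin F) : Continuous fun s : ℝ => N.V (Function.update h f s) :=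
  N.V_cont.comp (continuous_const.update f continuous_id)

lemma P_update_mono (h : Fin F → ℝ) (f : Fin F) {s t : ℝ} (hst : s ≤ t) :
    N.P (Function.update h f s) ⊆ N.P (Function.update h f t) := by
  intro x hx g
  refine (hx g).trans ?_
  by_cases hg : g = f
  · subst hg; simpa using hst
  · simp [Function.update_of_ne hg]

lemma mem_P_update {h : Fin F → ℝ} {f : Fin F} {s : ℝ} {x : E3} :
    x ∈ N.P (Function.update h f s) ↔
      inner ℝ x (N.w f) ≤ s ∧ ∀ g, g ≠ f → inner ℝ x (N.w g) ≤ h g := by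
  constructor
  · intro hx
    refine ⟨by simpa using hx f, fun g hg => ?_⟩
    simpa [Function.update_of_ne hg] using hx g
  · rintro ⟨h1, h2⟩ g
    by_cases hg : g = f
    · subst hg; simpa using h1
    · simpa [Function.update_of_ne hg] using h2 g hg

lemma profile {h : Fin F → ℝ} (hF : N.Feas h) (f : Fin F) (hS : 0 < N.S f h) :
    ∃ α, α < h f ∧ N.V (Function.update h f α) = 0 ∧
      (∀ s, α < s → N.Feas (Function.update h f s)) ∧
      ∀ s ∈ Set.Ioo α (h f), 0 < N.S f (Function.update h f s) := by
  obtain ⟨x0, hx0⟩ := id hF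
  obtain ⟨m, hm, hmin⟩ := (N.P_compact h).exists_isMinOn (f := fun x => (inner ℝ x (N.w f) : ℝ))
    ⟨x0, fun g => (hx0 g).le⟩ (by fun_prop)
  have hmin' : ∀ x ∈ N.P h, (inner ℝ m (N.w f) : ℝ) ≤ inner ℝ x (N.w f) := fun x hx => hmin hx
  have hα : inner ℝ m (N.w f) < h f := (hmin' x0 (fun g => (hx0 g).le)).trans_lt (hx0 f)
  have hFs : ∀ s, inner ℝ m (N.w f) < s → N.Feas (Function.update h f s) := by
    intro s hs
    set b : ℝ := inner ℝ x0 (N.w f) - inner ℝ m (N.w f) with hb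
    have hb0 : 0 ≤ b := sub_nonneg.2 (hmin' x0 fun g => (hx0 g).le)
    set c : ℝ := s - inner ℝ m (N.w f) with hc
    have hc0 : 0 < c := sub_pos.2 hs
    set e : ℝ := c / (b + c) with he
    have he0 : 0 < e := by positivity
    have he1 : e ≤ 1 := by rw [he, div_le_one (by positivity)]; linarith
    have heb : e * b < c := by
      rw [he, div_mul_eq_mul_div, div_lt_iff₀ (by positivity)]
      nlinarith
    refine ⟨(1 - e) • m + e • x0, fun g => ?_⟩
    simp only [inner_add_left, inner_smul_left, conj_trivial]
    by_cases hg : g = f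
    · subst hg
      rw [Function.update_self]
      have : (1 - e) * inner ℝ m (N.w g) + e * inner ℝ x0 (N.w g) = inner ℝ m (N.w g) + e * b := by
        rw [hb]; ring
      rw [this]; linarith
    · rw [Function.update_of_ne hg]
      have h1 := hm g
      have h2 := hx0 g
      nlinarith
  refine ⟨inner ℝ m (N.w f), hα, ?_, hFs, ?_⟩
  · rw [V, measureReal_def]
    have : volume (N.P (Function.update h f (inner ℝ m (N.w f)))) = 0 := by
      refine measure_mono_null (t := {x | innerₛₗ ℝ (N.w f) x = inner ℝ m (N.w f)}) ?_ ?_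
      · intro x hx
        have hxP : x ∈ N.P h := by
          have := N.P_update_mono h f hα.le hx
          rwa [Function.update_eq_self] at this
        have h1 := hmin' x hxP
        have h2 := (N.mem_P_update.1 hx).1
        simp only [Set.mem_ofPred_eq, innerₛₗ_apply_apply]
        rw [real_inner_comm]
        linarith
      · apply null_level
        intro h
        have := LinearMap.congr_fun h (N.w f)
        simp at this
        exact N.w_ne f this
    rw [this]; rfl
  · rintro s ⟨hs1, hs2⟩
    obtain ⟨z0, hz0⟩ := hFs s hs1
    have hne : (N.Sl f h).Nonempty := by
      rw [Set.nonempty_iff_ne_empty]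
      intro h0
      rw [S, h0] at hS
      simp at hS
    obtain ⟨y1, hy1⟩ := hne
    set m' := N.pt f (h f) y1 with hm'
    have hm'f : inner ℝ m' (N.w f) = h f := N.inner_pt f _ _
    have hz0f := hz0 f
    rw [Function.update_self] at hz0f
    set b : ℝ := s - inner ℝ z0 (N.w f) with hb
    set c : ℝ := h f - inner ℝ z0 (N.w f) with hc
    have hb0 : 0 < b := sub_pos.2 hz0f
    have hbc : b < c := by rw [hb, hc]; linarith
    have hc0 : 0 < c := hb0.trans hbc
    set e : ℝ := b / c with he
    have he0 : 0 < e := by positivity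
    have he1 : e < 1 := by rw [he, div_lt_one hc0]; exact hbc
    have hec : e * c = b := div_mul_cancel₀ _ hc0.ne'
    set z := (1 - e) • z0 + e • m' with hz
    have hzf : inner ℝ z (N.w f) = s := by
      simp only [hz, inner_add_left, inner_smul_left, conj_trivial, hm'f]
      rw [hb, hc] at hec
      linarith
    have hzg : ∀ g, g ≠ f → inner ℝ z (N.w g) < h g := by
      intro g hg
      have h1 := hz0 g
      rw [Function.update_of_ne hg] at h1
      have h2 := hy1 g
      simp only [hz, inner_add_left, inner_smul_left, conj_trivial]
      nlinarith
    obtain ⟨y, hy⟩ := N.exists_pt f z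
    rw [hzf] at hy
    have ho : IsOpen {y : ℝ × ℝ | ∀ g, g ≠ f → inner ℝ (N.pt f s y) (N.w g) < h g} := by
      simp only [Set.ofPred_forall]
      refine isOpen_iInter_of_finite fun g => isOpen_iInter_of_finite fun _ => isOpen_lt ?_ continuous_const
      unfold pt; fun_prop
    have hsub : {y : ℝ × ℝ | ∀ g, g ≠ f → inner ℝ (N.pt f s y) (N.w g) < h g} ⊆
        N.Sl f (Function.update h f s) := by
      intro y hy
      rw [Sl, Set.mem_ofPred_eq, Function.update_self, N.mem_P_update]
      exact ⟨(N.inner_pt f s y).le, fun g hg => (hy g hg).le⟩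
    have hpos := ho.measure_pos volume ⟨y, by
      intro g hg
      rw [hy]; exact hzg g hg⟩
    apply mul_pos (inv_pos.2 (N.norm_w_pos f))
    apply ENNReal.toReal_pos
    · exact (hpos.trans_le (measure_mono hsub)).ne'
    · exact ((measure_mono (N.Sl_sub f _)).trans_lt measure_closedBall_lt_top).ne

/-- pushforward of the volume on `P h` under the `f`-th linear functional. -/
def pushm (f : Fin F) (h : Fin F → ℝ) : Measure ℝ :=
  (volume.restrict (N.P h)).map (fun x => inner ℝ x (N.w f))

lemma meas_inner (f : Fin F) : Measurable fun x : E3 => (inner ℝ x (N.w f) : ℝ) := by fun_prop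

instance (f : Fin F) (h : Fin F → ℝ) : IsFiniteMeasure (N.pushm f h) := by
  have : IsFiniteMeasure (volume.restrict (N.P h)) :=
    ⟨by rw [Measure.restrict_apply_univ]; exact (N.P_compact h).measure_lt_top⟩
  unfold pushm
  infer_instance

lemma pushm_Iic (f : Fin F) (h : Fin F → ℝ) (s : ℝ) :
    N.pushm f h (Set.Iic s) = ENNReal.ofReal (N.V (Function.update h f (min s (h f)))) := by
  rw [pushm, Measure.map_apply (N.meas_inner f) measurableSet_Iic,
    Measure.restrict_apply (N.meas_inner f measurableSet_Iic), V, measureReal_def,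
    ENNReal.ofReal_toReal (N.P_compact _).measure_lt_top.ne]
  congr 1
  ext x
  rw [N.mem_P_update, Set.mem_inter_iff, Set.mem_preimage, Set.mem_Iic, le_min_iff]
  constructor
  · rintro ⟨h1, h2⟩
    exact ⟨⟨h1, h2 f⟩, fun g _ => h2 g⟩
  · rintro ⟨⟨h1, h2⟩, h3⟩
    refine ⟨h1, fun g => ?_⟩
    by_cases hg : g = f
    · subst hg; exact h2
    · exact h3 g hg

lemma shift {h₁ h₂ : Fin F → ℝ} (f₁ : N.Feas h₁) (f₂ : N.Feas h₂)
    (hV : N.V h₁ = N.V h₂) (hM : N.V (mid h₁ h₂) = N.V h₁) (f : Fin F)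
    (s₁ : 0 < N.S f h₁) (s₂ : 0 < N.S f h₂) :
    (h₂ f - h₁ f) * N.V h₁ =
      inner ℝ ((∫ x in N.P h₂, x) - ∫ x in N.P h₁, x) (N.w f) := by
  obtain ⟨α₁, l₁, z₁, F₁, S₁⟩ := N.profile f₁ f s₁
  obtain ⟨α₂, l₂, z₂, F₂, S₂⟩ := N.profile f₂ f s₂
  obtain ⟨δ, hδα, hδβ, hδ⟩ := transport (G₁ := fun s => N.V (Function.update h₁ f s))
    (G₂ := fun s => N.V (Function.update h₂ f s))
    (G := fun s => N.V (Function.update (mid h₁ h₂) f s))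
    (a₁ := fun s => N.S f (Function.update h₁ f s))
    (a₂ := fun s => N.S f (Function.update h₂ f s))
    (a := fun s => N.S f (Function.update (mid h₁ h₂) f s)) (V := N.V h₁)
    l₁ (N.update_cont h₁ f).continuousOn z₁ (by simp)
    (fun x hx => N.V_partial f h₁ x (F₁ x hx.1)) S₁
    l₂ (N.update_cont h₂ f).continuousOn z₂ (by simp [hV])
    (fun x hx => N.V_partial f h₂ x (F₂ x hx.1)) S₂
    (N.update_cont _ f) measureReal_nonneg
    (by
      have : Function.update (mid h₁ h₂) f ((h₁ f + h₂ f) / 2) = mid h₁ h₂ := by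
        rw [Function.update_eq_self_iff]; rfl
      simp only [this, hM]; exact le_rfl)
    (fun x hx y hy => N.V_partial f _ _ (by
      rw [update_mid]; exact N.Feas_mid (F₁ x hx.1) (F₂ y hy.1)))
    (fun x => N.S_nonneg f _)
    (fun x hx y hy => by
      simp only [update_mid]; exact N.S_bm f _ _)
  have hzero : ∀ (h : Fin F → ℝ) (α s : ℝ), N.V (Function.update h f α) = 0 → s ≤ α →
      N.V (Function.update h f s) = 0 := by
    intro h α s h0 hs
    apply le_antisymm _ measureReal_nonneg
    rw [← h0]
    exact measureReal_mono (N.P_update_mono h f hs) (N.P_compact _).measure_lt_top.ne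
  have hmap : N.pushm f h₂ = (N.pushm f h₁).map (fun s => s + δ) := by
    have : IsFiniteMeasure ((N.pushm f h₁).map (fun s => s + δ)) := inferInstance
    apply Measure.ext_of_Iic
    intro s
    rw [Measure.map_apply (measurable_add_const δ) measurableSet_Iic]
    have e : (fun s => s + δ) ⁻¹' Set.Iic s = Set.Iic (s - δ) := by
      ext x; simp [le_sub_iff_add_le]
    rw [e, pushm_Iic, pushm_Iic]
    congr 1
    have e2 : min s (h₂ f) = min (s - δ) (h₁ f) + δ := by
      rw [← min_add_add_right, hδβ]; simp
    rw [e2]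
    rcases le_total (min (s - δ) (h₁ f)) α₁ with hc | hc
    · rw [hzero h₁ α₁ _ z₁ hc, hzero h₂ α₂ _ z₂ (by rw [hδα]; linarith)]
    · exact hδ _ ⟨hc, min_le_right _ _⟩
  have hint : ∀ h, IntegrableOn (fun x : E3 => x) (N.P h) := fun h =>
    continuous_id.continuousOn.integrableOn_compact (N.P_compact h)
  have hc : ∀ h, ∫ s, s ∂(N.pushm f h) = inner ℝ (∫ x in N.P h, x) (N.w f) := by
    intro h
    rw [pushm, integral_map (N.meas_inner f).aemeasurable (by fun_prop), real_inner_comm,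
      ← integral_inner (hint h)]
    apply integral_congr_ae
    filter_upwards with x
    rw [real_inner_comm]
  have hi : Integrable (fun s : ℝ => s) (N.pushm f h₁) := by
    rw [pushm, integrable_map_measure (by fun_prop) (N.meas_inner f).aemeasurable]
    have : ContinuousOn (fun x : E3 => (inner ℝ x (N.w f) : ℝ)) (N.P h₁) := by fun_prop
    exact this.integrableOn_compact (N.P_compact h₁)
  have e1 : ∫ s, s ∂(N.pushm f h₂) = ∫ s, s ∂(N.pushm f h₁) + δ * N.V h₁ := by
    rw [hmap, integral_map (by fun_prop) (by fun_prop), integral_add hi (integrable_const δ),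
      integral_const]
    congr 1
    rw [smul_eq_mul, mul_comm]
    congr 1
    rw [measureReal_def, pushm, Measure.map_apply (N.meas_inner f) MeasurableSet.univ,
      Set.preimage_univ, Measure.restrict_apply_univ]
    rfl
  rw [hc, hc] at e1
  rw [inner_sub_left, e1, hδβ]
  ring

lemma unique_h {A h₁ h₂ : Fin F → ℝ} (hA : ∀ f, 0 < A f) (f₁ : N.Feas h₁) (f₂ : N.Feas h₂)
    (s₁ : ∀ f, N.S f h₁ = A f) (s₂ : ∀ f, N.S f h₂ = A f) : ∃ t : E3, h₂ = h₁ + N.tr t := by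
  obtain ⟨hV, hM⟩ := N.V_mid hA f₁ f₂ s₁ s₂
  refine ⟨(N.V h₁)⁻¹ • ((∫ x in N.P h₂, x) - ∫ x in N.P h₁, x), ?_⟩
  ext f
  have := N.shift f₁ f₂ hV hM f (by rw [s₁]; exact hA f) (by rw [s₂]; exact hA f)
  have hp := N.V_pos f₁
  simp only [Pi.add_apply, tr, inner_smul_left, conj_trivial, ← this]
  field_simp
  ring

end Fan

lemma mink_bdd {F : ℕ} (w : Fin F → E3) (A : Fin F → ℝ) (hA : ∀ f, 0 < A f)
    (hcl : ∑ f, A f • w f = 0) (hsp : Submodule.span ℝ (Set.range w) = ⊤) :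
    ∃ C : ℝ, 0 ≤ C ∧ ∀ (h : Fin F → ℝ) (x : E3), (∀ f, inner ℝ x (w f) ≤ h f) →
      ‖x‖ ≤ C * ∑ f, |h f| := by
  set L : E3 →ₗ[ℝ] (Fin F → ℝ) :=
    { toFun := fun x f => inner ℝ x (w f)
      map_add' := by intro x y; ext f; simp [inner_add_left]
      map_smul' := by intro c x; ext f; simp [inner_smul_left] } with hL
  have hker : LinearMap.ker L = ⊥ := by
    rw [LinearMap.ker_eq_bot']
    intro x hx
    have h1 : ∀ f, inner ℝ x (w f) = 0 := fun f => congrFun hx f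
    have h2 : ∀ y ∈ Submodule.span ℝ (Set.range w), inner ℝ x y = 0 := by
      intro y hy
      induction hy using Submodule.span_induction with
      | mem y hy => obtain ⟨f, rfl⟩ := hy; exact h1 f
      | zero => simp
      | add a b _ _ ha hb => rw [inner_add_right, ha, hb, add_zero]
      | smul c a _ ha => rw [inner_smul_right, ha, mul_zero]
    have := h2 x (by rw [hsp]; trivial)
    exact inner_self_eq_zero.1 this
  obtain ⟨K, hK, hanti⟩ := L.exists_antilipschitzWith hker
  set B : ℝ := 1 + ∑ f, (A f)⁻¹ with hB
  set D : ℝ := ∑ f, A f with hD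
  have hinv : ∀ f, (A f)⁻¹ ≤ ∑ f, (A f)⁻¹ := fun f =>
    Finset.single_le_sum (f := fun f => (A f)⁻¹) (fun g _ => (inv_pos.2 (hA g)).le) (Finset.mem_univ f)
  have hAD : ∀ f, A f ≤ D := fun f =>
    Finset.single_le_sum (f := A) (fun g _ => (hA g).le) (Finset.mem_univ f)
  have hB0 : 0 ≤ B := by
    have : 0 ≤ ∑ f, (A f)⁻¹ := Finset.sum_nonneg fun g _ => (inv_pos.2 (hA g)).le
    rw [hB]; linarith
  have hD0 : 0 ≤ D := Finset.sum_nonneg fun g _ => (hA g).le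
  refine ⟨K * (B * (D + 1)), by positivity, ?_⟩
  intro h x hx
  set T := ∑ f, |h f| with hT
  have hT0 : 0 ≤ T := Finset.sum_nonneg fun g _ => abs_nonneg _
  have hhT : ∀ f, |h f| ≤ T := fun f =>
    Finset.single_le_sum (f := fun f => |h f|) (fun g _ => abs_nonneg _) (Finset.mem_univ f)
  have hsum : ∑ f, A f * inner ℝ x (w f) = 0 := by
    have : ∑ f, A f * inner ℝ x (w f) = inner ℝ x (∑ f, A f • w f) := by
      rw [inner_sum]; simp [inner_smul_right]
    rw [this, hcl, inner_zero_right]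
  have hle : ∀ g, A g * inner ℝ x (w g) ≤ A g * |h g| := fun g =>
    mul_le_mul_of_nonneg_left ((hx g).trans (le_abs_self _)) (hA g).le
  have habs : ∀ f, |inner ℝ x (w f)| ≤ B * (D + 1) * T := by
    intro f
    have hAf := hA f
    have hB1 : 1 ≤ B * (D + 1) := by
      have h1 : 1 ≤ B := by
        have : 0 ≤ ∑ f, (A f)⁻¹ := Finset.sum_nonneg fun g _ => (inv_pos.2 (hA g)).le
        rw [hB]; linarith
      nlinarith
    rw [abs_le]
    constructor
    · -- lower bound
      have h1 : ∑ g, A g * (|h g| - inner ℝ x (w g)) ≤ D * T := by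
        simp only [mul_sub, Finset.sum_sub_distrib, hsum, sub_zero]
        rw [hD, Finset.sum_mul]
        exact Finset.sum_le_sum fun g _ => mul_le_mul_of_nonneg_left (hhT g) (hA g).le
      have h2 : A f * (|h f| - inner ℝ x (w f)) ≤ D * T := by
        refine le_trans ?_ h1
        exact Finset.single_le_sum (f := fun g => A g * (|h g| - inner ℝ x (w g)))
          (fun g _ => by have := hle g; rw [mul_sub]; linarith) (Finset.mem_univ f)
      have h3 : |h f| - inner ℝ x (w f) ≤ (A f)⁻¹ * (D * T) := by
        rw [← div_eq_inv_mul, le_div_iff₀ hAf]; linarith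
      have h4 : (A f)⁻¹ * (D * T) ≤ B * (D * T) := by
        apply mul_le_mul_of_nonneg_right _ (by positivity)
        have := hinv f; rw [hB]; linarith
      have h5 := abs_nonneg (h f)
      have h6 : 0 ≤ B * T := by positivity
      nlinarith
    · have h1 := (hx f).trans ((le_abs_self _).trans (hhT f))
      nlinarith
  have h1 : ‖L x‖ ≤ B * (D + 1) * T := by
    rw [pi_norm_le_iff_of_nonneg (by positivity)]
    intro f
    exact habs f
  have h2 := hanti.le_mul_dist x 0
  rw [map_zero, dist_zero_right, dist_zero_right] at h2
  calc ‖x‖ ≤ K * ‖L x‖ := h2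
    _ ≤ K * (B * (D + 1) * T) := by gcongr
    _ = _ := by ring

/-- the diagonal reflection turning `mink` into the Euclidean inner product. -/
def refl3 : E3 →ₗ[ℝ] E3 where
  toFun v := !₂[v 0, - v 1, - v 2]
  map_add' := by intro x y; ext i; fin_cases i <;> simp <;> ring
  map_smul' := by intro c x; ext i; fin_cases i <;> simp

lemma refl3_refl3 (v : E3) : refl3 (refl3 v) = v := by
  ext i; fin_cases i <;> simp [refl3]

lemma mink_eq (x v : E3) : mink x v = inner ℝ x (refl3 v) := by
  simp [mink, refl3, PiLp.inner_apply, Fin.sum_univ_three]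
  ring

lemma norm_refl3 (v : E3) : ‖refl3 v‖ = ‖v‖ := by
  simp [EuclideanSpace.norm_eq, refl3, Fin.sum_univ_three]

lemma mink_smul (c : ℝ) (v : E3) : mink (c • v) (c • v) = c ^ 2 * mink v v := by
  simp [mink]; ring

lemma exists_fan {F : ℕ} (v : Fin F → E3) (A : Fin F → ℝ)
    (hv_unit : ∀ f, mink (v f) (v f) = 1 ∨ mink (v f) (v f) = -1)
    (hv_inj : Function.Injective v)
    (hv_span : Submodule.span ℝ (Set.range v) = ⊤)
    (hA_pos : ∀ f, 0 < A f)
    (hclosure : ∑ f, A f • v f = 0) :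
    ∃ N : Fan F, (∀ f, N.w f = refl3 (v f)) ∧ ∑ f, A f • N.w f = 0 := by
  have hcl : ∑ f, A f • refl3 (v f) = 0 := by
    have := congrArg refl3 hclosure
    simpa using this
  have hsp : Submodule.span ℝ (Set.range fun f => refl3 (v f)) = ⊤ := by
    have h1 : Set.range (fun f => refl3 (v f)) = refl3 '' Set.range v := Set.range_comp refl3 v
    rw [h1, Submodule.span_image, hv_span, Submodule.map_top, LinearMap.range_eq_top]
    intro y
    exact ⟨refl3 y, refl3_refl3 y⟩
  obtain ⟨C, hC, hb⟩ := mink_bdd _ A hA_pos hcl hsp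
  have hne : ∀ f, refl3 (v f) ≠ 0 := by
    intro f h0
    have : mink (v f) (v f) = 0 := by rw [mink_eq, h0, inner_zero_right]
    rcases hv_unit f with h | h <;> rw [this] at h <;> norm_num at h
  refine ⟨⟨fun f => refl3 (v f), fun f => (exists_chart _ (hne f)).some, C, hC, hb, ?_⟩,
    fun f => rfl, hcl⟩
  intro f g hfg c hc h
  have h1 : v g = c • v f := by
    rw [← refl3_refl3 (v g)]
    have h' : refl3 (v g) = c • refl3 (v f) := h
    rw [h', map_smul, refl3_refl3]
  have h2 := mink_smul c (v f)
  rw [← h1] at h2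
  have hc1 : c = 1 := by
    rcases hv_unit f with hf | hf <;> rcases hv_unit g with hg | hg <;> rw [hf, hg] at h2 <;>
      nlinarith
  rw [hc1, one_smul] at h1
  exact hfg (hv_inj h1.symm)

section glue
variable {F : ℕ} (N : Fan F)

lemma P_eq_mink {v : Fin F → E3} (hw : ∀ f, N.w f = refl3 (v f)) (h : Fin F → ℝ) :
    (⋂ f, {x | mink x (v f) ≤ h f}) = N.P h := by
  ext x
  simp [Fan.P, mink_eq, hw]

lemma area_eq {v : Fin F → E3} (hw : ∀ f, N.w f = refl3 (v f)) (h : Fin F → ℝ) (f : Fin F)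
    (x0 : E3) (hx0 : x0 ∈ N.P h) (hx : inner ℝ x0 (N.w f) = h f) :
    minkArea (mface (N.P h) (v f)) (v f) = hausC * N.S f h := by
  have e : mface (N.P h) (v f) = N.P h ∩ {x | inner ℝ x (N.w f) = h f} := by
    ext x
    simp only [mface, mink_eq, ← hw, Set.mem_ofPred_eq, Set.mem_inter_iff]
    apply and_congr_right
    intro hxP
    constructor
    · intro hm
      have h1 := hm x0 hx0
      rw [hx] at h1
      exact le_antisymm (hxP f) h1
    · intro hm y hy
      rw [hm]; exact hy f
  rw [minkArea, e, (N.ch f).haus _ _ (N.P_closed h).measurableSet, ← norm_refl3 (v f), ← hw,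
    ENNReal.toReal_mul, Fan.S, measureReal_def]
  simp only [ENNReal.coe_toReal]
  have : {y : ℝ × ℝ | h f • (N.ch f).n + y.1 • (N.ch f).p + y.2 • (N.ch f).q ∈ N.P h} = N.Sl f h := rfl
  rw [this]
  ring

lemma tight_of_S {h : Fin F → ℝ} {f : Fin F} (hS : 0 < N.S f h) :
    ∃ x ∈ N.P h, inner ℝ x (N.w f) = h f := by
  have hne : (N.Sl f h).Nonempty := by
    rw [Set.nonempty_iff_ne_empty]
    intro h0
    rw [Fan.S, h0] at hS
    simp at hS
  obtain ⟨y, hy⟩ := hne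
  exact ⟨_, hy, N.inner_pt f _ _⟩

lemma exists_tight {h : Fin F → ℝ} (hne : (N.P h).Nonempty) :
    ∃ k : Fin F → ℝ, N.P k = N.P h ∧ ∀ f, ∃ x ∈ N.P k, inner ℝ x (N.w f) = k f := by
  have : ∀ f, ∃ m ∈ N.P h, ∀ x ∈ N.P h, (inner ℝ x (N.w f) : ℝ) ≤ inner ℝ m (N.w f) := by
    intro f
    obtain ⟨m, hm, hmax⟩ := (N.P_compact h).exists_isMaxOn (f := fun x => (inner ℝ x (N.w f) : ℝ))
      hne (by fun_prop)
    exact ⟨m, hm, fun x hx => hmax hx⟩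
  choose m hm hmax using this
  have e : N.P (fun f => inner ℝ (m f) (N.w f)) = N.P h := by
    ext x
    constructor
    · intro hx f
      exact (hx f).trans (hm f f)
    · intro hx f
      exact hmax f x hx
  refine ⟨fun f => inner ℝ (m f) (N.w f), e, fun f => ⟨m f, ?_, rfl⟩⟩
  rw [e]; exact hm f

end glue

/-- Minkowski's theorem in Lorentzian signature: given finitely many
pairwise-distinct unit non-null normals `v f` in `ℝ^{2,1}`, not all contained in a plane,
and positive numbers `A f` with `Σ_f A_f v_f = 0`, there exists a convex Minkowskian
polyhedron — a bounded intersection of half-spaces `{x | ⟨x, v f⟩ ≤ h f}` with nonempty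
interior — whose face with outward normal `v f` has Minkowskian area `A f`; and it is
unique up to translation. -/
theorem minkowski_theorem_lorentzian
    (F : ℕ) (v : Fin F → EuclideanSpace ℝ (Fin 3)) (A : Fin F → ℝ)
    (hv_unit : ∀ f, mink (v f) (v f) = 1 ∨ mink (v f) (v f) = -1)
    (hv_inj : Function.Injective v)
    (hv_span : Submodule.span ℝ (Set.range v) = ⊤)
    (hA_pos : ∀ f, 0 < A f)
    (hclosure : ∑ f, A f • v f = 0) :
    (∃ (h : Fin F → ℝ) (P : Set (EuclideanSpace ℝ (Fin 3))),
      P = ⋂ f, {x | mink x (v f) ≤ h f} ∧ IsCompact P ∧ (interior P).Nonempty ∧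
      ∀ f, minkArea (mface P (v f)) (v f) = A f) ∧
    (∀ (h₁ h₂ : Fin F → ℝ) (P₁ P₂ : Set (EuclideanSpace ℝ (Fin 3))),
      P₁ = ⋂ f, {x | mink x (v f) ≤ h₁ f} → IsCompact P₁ → (interior P₁).Nonempty →
      (∀ f, minkArea (mface P₁ (v f)) (v f) = A f) →
      P₂ = ⋂ f, {x | mink x (v f) ≤ h₂ f} → IsCompact P₂ → (interior P₂).Nonempty →
      (∀ f, minkArea (mface P₂ (v f)) (v f) = A f) →
      ∃ t : EuclideanSpace ℝ (Fin 3), P₂ = (fun x => x + t) '' P₁) := by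
  obtain ⟨N, hw, hcl⟩ := exists_fan v A hv_unit hv_inj hv_span hA_pos hclosure
  have hc : (0:ℝ) < hausC := NNReal.coe_pos.2 hausC_pos
  have hA' : ∀ f, 0 < (hausC : ℝ)⁻¹ * A f := fun f => mul_pos (inv_pos.2 hc) (hA_pos f)
  constructor
  · obtain ⟨h, hF, hS⟩ := N.exists_h (A := fun f => (hausC : ℝ)⁻¹ * A f) hA' (by
      simp only [mul_smul, ← Finset.smul_sum, hcl, smul_zero])
    refine ⟨h, N.P h, (P_eq_mink N hw h).symm, N.P_compact h, N.interior_of_Feas hF, fun f => ?_⟩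
    obtain ⟨x, hx, hxf⟩ := tight_of_S N (h := h) (f := f) (by rw [hS]; exact hA' f)
    rw [area_eq N hw h f x hx hxf, hS, mul_inv_cancel_left₀ hc.ne']
  · intro h₁ h₂ P₁ P₂ e₁ _ i₁ a₁ e₂ _ i₂ a₂
    rw [P_eq_mink N hw] at e₁ e₂
    subst e₁ e₂
    have key : ∀ h, (interior (N.P h)).Nonempty →
        (∀ f, minkArea (mface (N.P h) (v f)) (v f) = A f) →
        ∃ k, N.P k = N.P h ∧ N.Feas k ∧ ∀ f, N.S f k = (hausC : ℝ)⁻¹ * A f := by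
      intro h hi ha
      obtain ⟨k, hk, ht⟩ := exists_tight N (hi.mono interior_subset)
      refine ⟨k, hk, N.Feas_of_interior (by rw [hk]; exact hi), fun f => ?_⟩
      obtain ⟨x, hx, hxf⟩ := ht f
      have := area_eq N hw k f x hx hxf
      rw [hk, ha] at this
      rw [this, inv_mul_cancel_left₀ hc.ne']
    obtain ⟨k₁, hk₁, f₁, s₁⟩ := key h₁ i₁ a₁
    obtain ⟨k₂, hk₂, f₂, s₂⟩ := key h₂ i₂ a₂
    obtain ⟨t, ht⟩ := N.unique_h hA' f₁ f₂ s₁ s₂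
    refine ⟨t, ?_⟩
    rw [← hk₁, ← hk₂, ht, N.P_tr]
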